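/- arXiv:1707.06296 — 2 statements merged into one kernel-verified Lean document; each statement's English description precedes it below -/
import Mathlib

section
/- Let W : [0,1]² → ℝ be a measurable function with 0 ≤ W ≤ 1 (a graphon). For every ε with 0 < ε ≤ 1 there exist a natural number n with n ≤ (5/ε³)^{1/ε²}, a measurable partition [0,1] = V₁ ⊔ ⋯ ⊔ Vₙ, and real numbers c_{ij} (1 ≤ i,j ≤ n) such that, writing W⁶ = W ∘ W* ∘ W ∘ W* ∘ W ∘ W*, one has |W⁶(x,y) − c_{ij}| ≤ 2ε² for almost every (x,y) ∈ V_i × V_j and all i, j. -/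
open MeasureTheory Set

/-- The operator product of two kernels: `(U ∘ W)(x,y) = ∫₀¹ U(x,z) W(z,y) dz`. -/
noncomputable def opProd (U W : ℝ → ℝ → ℝ) : ℝ → ℝ → ℝ :=
  fun x y => ∫ z in Set.Icc (0 : ℝ) 1, U x z * W z y

/-- The transpose kernel: `W*(x,y) = W(y,x)`. -/
def transposeKernel (W : ℝ → ℝ → ℝ) : ℝ → ℝ → ℝ := fun x y => W y x

/-- The sixth power `W⁶ = W ∘ W* ∘ W ∘ W* ∘ W ∘ W*`. -/
noncomputable def sixthPower (W : ℝ → ℝ → ℝ) : ℝ → ℝ → ℝ :=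
  opProd W (opProd (transposeKernel W) (opProd W
    (opProd (transposeKernel W) (opProd W (transposeKernel W)))))

theorem abs_lemma {E F : Type*} [NormedAddCommGroup E] [InnerProductSpace ℝ E]
    [NormedAddCommGroup F] [InnerProductSpace ℝ F] (T : E →ₗ[ℝ] F)
    (hT : ∀ (n : ℕ) (e : Fin n → E), Orthonormal ℝ e → ∑ i, ‖T (e i)‖ ^ 2 ≤ 1)
    (δ : ℝ) (hδ : 0 < δ) :
    ∃ K : Submodule ℝ F, FiniteDimensional ℝ K ∧ (Module.finrank ℝ K : ℝ) ≤ 1 / δ ∧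
      ∀ (f : E) (w : F), ‖w‖ ≤ 1 → (∀ q : E, inner ℝ q f = inner ℝ (T q) w) →
        ∃ k ∈ K, ‖T f - k‖ ≤ δ := by
  classical
  let P : ℕ → Prop := fun n => ∃ e : Fin n → E, Orthonormal ℝ e ∧ ∀ i, δ ≤ ‖T (e i)‖ ^ 2
  have hPb : ∀ n, P n → (n : ℝ) ≤ 1 / δ := by
    rintro n ⟨e, he, h⟩
    have h1 := hT n e he
    have h2 : ∑ i : Fin n, δ ≤ ∑ i, ‖T (e i)‖ ^ 2 := Finset.sum_le_sum fun i _ => h i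
    simp at h2
    rw [le_div_iff₀ hδ]; linarith
  have hP0 : P 0 := ⟨Fin.elim0, by constructor <;> intro i <;> exact i.elim0, fun i => i.elim0⟩
  let N := ⌊1 / δ⌋₊
  let n := Nat.findGreatest P N
  have hn : P n := Nat.findGreatest_spec (Nat.zero_le N) hP0
  have hn1 : ¬ P (n + 1) := by
    intro h
    have h1 : n + 1 ≤ N := Nat.le_floor (by exact_mod_cast hPb _ h)
    have := Nat.le_findGreatest h1 h
    exact absurd this (by simp [n])
  obtain ⟨e, he, hge⟩ := id hn
  have key : ∀ q : E, (∀ i, inner ℝ (e i) q = 0) → ‖T q‖ ^ 2 ≤ δ * ‖q‖ ^ 2 := by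
    intro q hq
    by_contra! hlt
    have hq0 : q ≠ 0 := by rintro rfl; simp at hlt
    have hqn : 0 < ‖q‖ := norm_pos_iff.mpr hq0
    apply hn1
    refine ⟨Fin.cons (‖q‖⁻¹ • q) e, ?_, ?_⟩
    · constructor
      · intro i
        refine Fin.cases ?_ (fun j => ?_) i
        · simp [norm_smul, hqn.ne']
        · simpa using he.1 j
      · intro i j
        refine Fin.cases ?_ (fun i => ?_) i <;> refine Fin.cases ?_ (fun j => ?_) j
        · simp
        · intro _
          have h0 : inner ℝ q (e j) = 0 := by rw [real_inner_comm]; exact hq j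
          simp [inner_smul_left, h0]
        · intro _
          simp [inner_smul_right, hq]
        · intro h
          simpa using he.2 (fun h' => h (by rw [h']))
    · intro i
      refine Fin.cases ?_ (fun j => ?_) i
      · simp only [Fin.cons_zero, map_smul, norm_smul, norm_inv, norm_norm, mul_pow]
        rw [inv_pow, inv_mul_eq_div, le_div_iff₀ (by positivity)]
        exact hlt.le
      · simpa using hge j
  let S := Submodule.span ℝ (Set.range e)
  have : FiniteDimensional ℝ S := FiniteDimensional.span_of_finite ℝ (Set.finite_range e)
  refine ⟨S.map T, inferInstance, ?_, ?_⟩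
  · refine le_trans ?_ (hPb n hn)
    have h1 : Module.finrank ℝ (S.map T) ≤ Module.finrank ℝ S := Submodule.finrank_map_le T S
    have h2 : Module.finrank ℝ S ≤ n := by
      have h3 := finrank_range_le_card (R := ℝ) e
      rw [Fintype.card_fin] at h3
      exact h3
    exact_mod_cast h1.trans h2
  · intro f w hw hf
    let p : E := S.starProjection f
    have hp : p ∈ S := Submodule.starProjection_apply_mem S f
    have hq : f - p ∈ Sᗮ := Submodule.sub_starProjection_mem_orthogonal f
    refine ⟨T p, Submodule.mem_map_of_mem hp, ?_⟩
    rw [← map_sub]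
    set q := f - p with hqdef
    have hk := key q (fun i => hq _ (Submodule.subset_span ⟨i, rfl⟩))
    have h1 : ‖q‖ ^ 2 = inner ℝ q f := by
      have : f = q + p := by simp [hqdef]
      rw [this, inner_add_right, real_inner_self_eq_norm_sq, real_inner_comm, hq p hp, add_zero]
    rw [hf q] at h1
    have h2 : inner ℝ (T q) w ≤ ‖T q‖ := by
      refine (real_inner_le_norm _ _).trans ?_
      nlinarith [norm_nonneg (T q)]
    have h3 : ‖T q‖ ^ 2 ≤ δ * ‖T q‖ := hk.trans (by gcongr; linarith)
    by_contra! h4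
    nlinarith [norm_nonneg (T q)]

theorem cell_lemma {F : Type*} [NormedAddCommGroup F] [InnerProductSpace ℝ F]
    (g : ℝ → F) (hg1 : ∀ x, ‖g x‖ ≤ 1) (hgm : ∀ b : F, Measurable fun x => inner ℝ b (g x))
    (ε : ℝ) (hε : 0 < ε) (hε1 : ε ≤ 1)
    (K : Submodule ℝ F) [FiniteDimensional ℝ K] (hK : (Module.finrank ℝ K : ℝ) ≤ 1 / ε ^ 2)
    (hgK : ∀ x, ∃ k ∈ K, ‖g x - k‖ ≤ ε ^ 2) :
    ∃ n : ℕ, (n : ℝ) ≤ (5 / ε ^ 3) ^ ((1 : ℝ) / ε ^ 2) ∧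
      ∃ V : Fin n → Set ℝ, (∀ i, MeasurableSet (V i)) ∧
        Pairwise (Function.onFun Disjoint V) ∧ (⋃ i, V i) = Set.Icc (0 : ℝ) 1 ∧
        ∃ c : Fin n → Fin n → ℝ, ∀ i j, ∀ x ∈ V i, ∀ y ∈ V j,
            |inner ℝ (g x) (g y) - c i j| ≤ 2 * ε ^ 2 := by
  classical
  set k := Module.finrank ℝ K with hkdef
  let b := stdOrthonormalBasis ℝ K
  let M := ⌊4 / ε ^ 3⌋₊ + 1
  have hε3 : 0 < ε ^ 3 := by positivity
  have hε31 : ε ^ 3 ≤ 1 := pow_le_one₀ hε.le hε1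
  have hM : (M : ℝ) ≤ 5 / ε ^ 3 := by
    have h1 : ((⌊4 / ε ^ 3⌋₊ : ℕ) : ℝ) ≤ 4 / ε ^ 3 := Nat.floor_le (by positivity)
    have h2 : 1 ≤ 1 / ε ^ 3 := by rw [le_div_iff₀ hε3]; linarith
    have : 5 / ε ^ 3 = 4 / ε ^ 3 + 1 / ε ^ 3 := by ring
    push_cast [M]; linarith
  let t : ℝ → Fin k → ℝ := fun x i => inner ℝ (b i : F) (g x)
  have ht : ∀ x i, |t x i| ≤ 1 := by
    intro x i
    refine (abs_real_inner_le_norm _ _).trans ?_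
    have : ‖(b i : F)‖ = 1 := b.orthonormal.1 i
    rw [this, one_mul]; exact hg1 x
  let s : ℝ → Fin k → ℝ := fun x i => 2 * (t x i + 1) / ε ^ 3
  have hs0 : ∀ x i, 0 ≤ s x i := by
    intro x i
    have := abs_le.mp (ht x i)
    exact div_nonneg (by linarith) hε3.le
  have hs1 : ∀ x i, ⌊s x i⌋₊ < M := by
    intro x i
    refine Nat.lt_succ_of_le (Nat.floor_le_floor ?_)
    have := abs_le.mp (ht x i)
    simp only [s]; gcongr; linarith
  let φ : ℝ → (Fin k → Fin M) := fun x i => ⟨⌊s x i⌋₊, hs1 x i⟩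
  have hφ : Measurable φ := by
    apply measurable_pi_lambda
    intro i
    have h1 : Measurable fun x => ⌊s x i⌋₊ :=
      Nat.measurable_floor.comp ((((hgm (b i)).add_const 1).const_mul 2).div_const _)
    refine measurable_to_countable' fun a => ?_
    have : (fun x => φ x i) ⁻¹' {a} = (fun x => ⌊s x i⌋₊) ⁻¹' {a.1} := by
      ext x; simp [φ, Fin.ext_iff]
    rw [this]; exact h1 (measurableSet_singleton _)
  let pr : ℝ → F := fun x => K.starProjection (g x)
  have hpr1 : ∀ x, ‖pr x‖ ≤ 1 := fun x =>
    (K.norm_starProjection_apply_le (g x)).trans (hg1 x)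
  have hres : ∀ x, ‖g x - pr x‖ ≤ ε ^ 2 := by
    intro x
    obtain ⟨c, hc, h⟩ := hgK x
    refine le_trans ?_ h
    have := K.starProjection_minimal (g x)
    simp only [pr]
    rw [this]
    exact ciInf_le ⟨0, by rintro _ ⟨y, rfl⟩; positivity⟩ (⟨c, hc⟩ : K)
  have hsplit : ∀ x y, inner ℝ (g x) (g y) = inner ℝ (pr x) (pr y) +
      inner ℝ (g x - pr x) (g y - pr y) := by
    intro x y
    have hx : g x - pr x ∈ Kᗮ := Submodule.sub_starProjection_mem_orthogonal _
    have hy : g y - pr y ∈ Kᗮ := Submodule.sub_starProjection_mem_orthogonal _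
    have e1 : inner ℝ (pr x) (g y - pr y) = 0 := hy _ (Submodule.starProjection_apply_mem K _)
    have e2 : inner ℝ (g x - pr x) (pr y) = 0 := by
      rw [real_inner_comm]; exact hx _ (Submodule.starProjection_apply_mem K _)
    rw [inner_sub_right] at e1
    rw [inner_sub_left] at e2
    rw [inner_sub_left, inner_sub_right, inner_sub_right]
    linarith
  have hclose : ∀ x x', φ x = φ x' → ‖pr x - pr x'‖ ≤ ε ^ 2 / 2 := by
    intro x x' h
    have hd : ∀ i, |t x i - t x' i| ≤ ε ^ 3 / 2 := by
      intro i
      have h1 : ⌊s x i⌋₊ = ⌊s x' i⌋₊ := by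
        have := congrFun h i; simpa [φ] using this
      have a1 := Nat.floor_le (hs0 x i)
      have a2 := Nat.lt_floor_add_one (s x i)
      have b1 := Nat.floor_le (hs0 x' i)
      have b2 := Nat.lt_floor_add_one (s x' i)
      rw [h1] at a1 a2
      have h3 : |s x i - s x' i| ≤ 1 := by rw [abs_le]; constructor <;> linarith
      have h4 : t x i - t x' i = (ε ^ 3 / 2) * (s x i - s x' i) := by
        simp only [s]; field_simp; ring
      rw [h4, abs_mul, abs_of_pos (by positivity)]
      nlinarith
    have hn : ‖pr x - pr x'‖ ^ 2 = ∑ i, (t x i - t x' i) ^ 2 := by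
      have h1 : pr x - pr x' = (K.orthogonalProjectionOnto (g x - g x') : F) := by
        rw [← Submodule.starProjection_apply, map_sub]
      have h2 : ‖(K.orthogonalProjectionOnto (g x - g x') : F)‖ =
        ‖K.orthogonalProjectionOnto (g x - g x')‖ := rfl
      rw [h1, h2, ← b.sum_sq_norm_inner_right]
      refine Finset.sum_congr rfl fun i _ => ?_
      rw [Submodule.inner_orthogonalProjectionOnto_eq_of_mem_left, inner_sub_right,
        Real.norm_eq_abs, sq_abs]
    have hsum : ∑ i, (t x i - t x' i) ^ 2 ≤ (ε ^ 2 / 2) ^ 2 := by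
      calc ∑ i, (t x i - t x' i) ^ 2 ≤ ∑ i : Fin k, (ε ^ 3 / 2) ^ 2 :=
            Finset.sum_le_sum fun i _ => sq_le_sq' (by linarith [(abs_le.mp (hd i)).1])
              (abs_le.mp (hd i)).2
        _ = k * (ε ^ 3 / 2) ^ 2 := by simp
        _ ≤ (1 / ε ^ 2) * (ε ^ 3 / 2) ^ 2 := by gcongr
        _ = _ := by field_simp
    rw [← hn] at hsum
    exact (sq_le_sq₀ (norm_nonneg _) (by positivity)).1 hsum
  have hmain : ∀ x x' y y', φ x = φ x' → φ y = φ y' →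
      |inner ℝ (g x) (g y) - inner ℝ (pr x') (pr y')| ≤ 2 * ε ^ 2 := by
    intro x x' y y' hx hy
    have e : inner ℝ (g x) (g y) - inner ℝ (pr x') (pr y') =
        inner ℝ (g x - pr x) (g y - pr y) + inner ℝ (pr x - pr x') (pr y) +
          inner ℝ (pr x') (pr y - pr y') := by
      rw [hsplit x y, inner_sub_left (pr x), inner_sub_right (pr x')]; ring
    rw [e]
    have i1 : |inner ℝ (g x - pr x) (g y - pr y)| ≤ ε ^ 2 * ε ^ 2 :=
      (abs_real_inner_le_norm _ _).trans (by gcongr <;> apply hres)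
    have i2 : |inner ℝ (pr x - pr x') (pr y)| ≤ ε ^ 2 / 2 * 1 :=
      (abs_real_inner_le_norm _ _).trans (by gcongr; exacts [hclose _ _ hx, hpr1 _])
    have i3 : |inner ℝ (pr x') (pr y - pr y')| ≤ 1 * (ε ^ 2 / 2) :=
      (abs_real_inner_le_norm _ _).trans (by gcongr; exacts [hpr1 _, hclose _ _ hy])
    have h1 : ε ^ 2 * ε ^ 2 ≤ ε ^ 2 * 1 := by gcongr; exact pow_le_one₀ hε.le hε1
    refine (abs_add_three _ _ _).trans ?_
    linarith
  let r : (Fin k → Fin M) → ℝ := fun a => if h : ∃ x, φ x = a then h.choose else 0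
  have hr : ∀ x, φ x = φ (r (φ x)) := by
    intro x
    have h : ∃ x', φ x' = φ x := ⟨x, rfl⟩
    simp only [r, dif_pos h]
    exact h.choose_spec.symm
  let eq := (finFunctionFinEquiv : (Fin k → Fin M) ≃ Fin (M ^ k))
  refine ⟨M ^ k, ?_, fun i => Icc 0 1 ∩ φ ⁻¹' {eq.symm i}, ?_, ?_, ?_,
    fun i j => inner ℝ (pr (r (eq.symm i))) (pr (r (eq.symm j))), ?_⟩
  · push_cast
    calc (M : ℝ) ^ k ≤ (5 / ε ^ 3) ^ k := by gcongr
      _ = (5 / ε ^ 3) ^ (k : ℝ) := (Real.rpow_natCast _ _).symm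
      _ ≤ _ := Real.rpow_le_rpow_of_exponent_le (by rw [le_div_iff₀ hε3]; linarith) hK
  · intro i
    exact measurableSet_Icc.inter (hφ (measurableSet_singleton _))
  · intro i j hij
    refine Set.disjoint_left.mpr ?_
    rintro x ⟨_, hx⟩ ⟨_, hx'⟩
    simp only [mem_preimage, mem_singleton_iff] at hx hx'
    exact hij (eq.symm.injective (hx.symm.trans hx'))
  · ext x
    simp only [mem_iUnion, mem_inter_iff, mem_preimage, mem_singleton_iff]
    exact ⟨fun ⟨_, h, _⟩ => h, fun h => ⟨eq (φ x), h, by simp⟩⟩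
  · rintro i j x ⟨_, hx⟩ y ⟨_, hy⟩
    simp only [mem_preimage, mem_singleton_iff] at hx hy
    beta_reduce
    rw [← hx, ← hy]
    exact hmain _ _ _ _ (hr x) (hr y)

/-- Lebesgue measure on the unit interval. -/
noncomputable abbrev mu : Measure ℝ := volume.restrict (Set.Icc (0 : ℝ) 1)

instance mu_prob : IsProbabilityMeasure mu := ⟨by simp [mu]⟩

/-- bounded measurable kernels -/
structure Ker (A : ℝ → ℝ → ℝ) : Prop where
  meas : Measurable (Function.uncurry A)
  bdd : ∀ x y, |A x y| ≤ 1

theorem Ker.transpose {A : ℝ → ℝ → ℝ} (hA : Ker A) : Ker (transposeKernel A) :=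
  ⟨hA.meas.comp measurable_swap, fun x y => hA.bdd y x⟩

theorem Ker.left {A : ℝ → ℝ → ℝ} (hA : Ker A) (x : ℝ) : Measurable (fun z => A x z) :=
  hA.meas.comp measurable_prodMk_left

theorem Ker.right {A : ℝ → ℝ → ℝ} (hA : Ker A) (y : ℝ) : Measurable (fun z => A z y) :=
  hA.meas.comp measurable_prodMk_right

theorem abs_mul_le_one' {a b : ℝ} (ha : |a| ≤ 1) (hb : |b| ≤ 1) : |a * b| ≤ 1 := by
  rw [abs_mul]; exact mul_le_one₀ ha (abs_nonneg _) hb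

theorem Ker.opProd {A B : ℝ → ℝ → ℝ} (hA : Ker A) (hB : Ker B) : Ker (opProd A B) := by
  constructor
  · have h : Measurable (fun q : (ℝ × ℝ) × ℝ => A q.1.1 q.2 * B q.2 q.1.2) :=
      (hA.meas.comp (measurable_fst.fst.prodMk measurable_snd)).mul
        (hB.meas.comp (measurable_snd.prodMk measurable_fst.snd))
    exact (h.stronglyMeasurable.integral_prod_right' (ν := mu)).measurable
  · intro x y
    have := norm_integral_le_of_norm_le_const (μ := mu) (f := fun z => A x z * B z y) (C := 1)
      (Filter.Eventually.of_forall fun z => abs_mul_le_one' (hA.bdd _ _) (hB.bdd _ _))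
    simp only [probReal_univ, mul_one] at this
    exact this

theorem transpose_opProd (A B : ℝ → ℝ → ℝ) :
    transposeKernel (opProd A B) = opProd (transposeKernel B) (transposeKernel A) := by
  funext x y
  simp only [transposeKernel, opProd]
  congr 1; funext z; ring

theorem opProd_assoc {A B C : ℝ → ℝ → ℝ} (hA : Ker A) (hB : Ker B) (hC : Ker C) :
    opProd (opProd A B) C = opProd A (opProd B C) := by
  funext x y
  simp only [opProd]
  simp_rw [← integral_const_mul, ← integral_mul_const]
  rw [integral_integral_swap]
  · simp_rw [mul_assoc]
  · have h : Measurable (fun q : ℝ × ℝ => A x q.2 * B q.2 q.1 * C q.1 y) :=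
      (((hA.left x).comp measurable_snd).mul (hB.meas.comp measurable_swap)).mul
        ((hC.right y).comp measurable_fst)
    exact Integrable.of_bound (μ := mu.prod mu) h.aestronglyMeasurable 1
      (Filter.Eventually.of_forall fun q =>
        abs_mul_le_one' (abs_mul_le_one' (hA.bdd _ _) (hB.bdd _ _)) (hC.bdd _ _))

/-- the Hilbert space -/
noncomputable abbrev HH := Lp ℝ 2 mu

theorem memLp_bdd {f : ℝ → ℝ} (hf : Measurable f) {C : ℝ} (h : ∀ x, |f x| ≤ C) :
    MemLp f 2 mu :=
  MemLp.of_bound hf.aestronglyMeasurable C (Filter.Eventually.of_forall h)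

/-- row of a kernel as an element of `L²` -/
noncomputable def row {A : ℝ → ℝ → ℝ} (hA : Ker A) (x : ℝ) : HH :=
  (memLp_bdd (hA.left x) (hA.bdd x)).toLp

theorem row_coe {A : ℝ → ℝ → ℝ} (hA : Ker A) (x : ℝ) : row hA x =ᵐ[mu] A x :=
  MemLp.coeFn_toLp _

theorem norm_row {A : ℝ → ℝ → ℝ} (hA : Ker A) (x : ℝ) : ‖row hA x‖ ≤ 1 := by
  have := Lp.norm_le_of_ae_bound (f := row hA x) (C := 1) zero_le_one (by
    filter_upwards [row_coe hA x] with z hz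
    rw [hz]; exact hA.bdd x z)
  refine this.trans (le_of_eq ?_)
  simp [measureUnivNNReal]

theorem inner_row {A : ℝ → ℝ → ℝ} (hA : Ker A) (x : ℝ) (q : HH) :
    inner ℝ q (row hA x) = ∫ z, A x z * q z ∂mu := by
  rw [L2.inner_def]
  refine integral_congr_ae ?_
  filter_upwards [row_coe hA x] with z hz
  rw [hz]; simp

/-- adjoint operator on functions: `(T q)(z) = ∫ U(ξ,z) q(ξ) dξ`. -/
noncomputable def Tf {U : ℝ → ℝ → ℝ} (hU : Ker U) (q : HH) (z : ℝ) : ℝ :=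
  inner ℝ q (row hU.transpose z)

theorem Tf_eq {U : ℝ → ℝ → ℝ} (hU : Ker U) (q : HH) (z : ℝ) :
    Tf hU q z = ∫ ξ, U ξ z * q ξ ∂mu := inner_row _ _ _

theorem Tf_meas {U : ℝ → ℝ → ℝ} (hU : Ker U) (q : HH) : Measurable (Tf hU q) := by
  have h : Measurable (fun p : ℝ × ℝ => U p.2 p.1 * q p.2) :=
    (hU.meas.comp measurable_swap).mul ((Lp.stronglyMeasurable q).measurable.comp measurable_snd)
  have := (h.stronglyMeasurable.integral_prod_right' (ν := mu)).measurable
  have e : Tf hU q = fun z => ∫ ξ, U ξ z * q ξ ∂mu := funext (Tf_eq hU q)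
  rw [e]; exact this

theorem Tf_bdd {U : ℝ → ℝ → ℝ} (hU : Ker U) (q : HH) (z : ℝ) : |Tf hU q z| ≤ ‖q‖ := by
  refine (abs_real_inner_le_norm _ _).trans ?_
  have := norm_row hU.transpose z
  nlinarith [norm_nonneg q]

/-- adjoint operator on `L²` -/
noncomputable def TT {U : ℝ → ℝ → ℝ} (hU : Ker U) : HH →ₗ[ℝ] HH where
  toFun q := (memLp_bdd (Tf_meas hU q) (Tf_bdd hU q)).toLp
  map_add' a b := by
    rw [← MemLp.toLp_add]
    congr 1
    funext z
    simp [Tf, inner_add_left]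
  map_smul' c a := by
    rw [RingHom.id_apply, ← MemLp.toLp_const_smul]
    congr 1
    funext z
    simp [Tf, inner_smul_left]

theorem TT_coe {U : ℝ → ℝ → ℝ} (hU : Ker U) (q : HH) : TT hU q =ᵐ[mu] Tf hU q :=
  MemLp.coeFn_toLp (memLp_bdd (Tf_meas hU q) (Tf_bdd hU q))

theorem TT_trace {U : ℝ → ℝ → ℝ} (hU : Ker U) (n : ℕ) (e : Fin n → HH) (he : Orthonormal ℝ e) :
    ∑ i, ‖TT hU (e i)‖ ^ 2 ≤ 1 := by
  have h1 : ∀ i, ‖TT hU (e i)‖ ^ 2 = ∫ z, (Tf hU (e i) z) ^ 2 ∂mu := by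
    intro i
    rw [← real_inner_self_eq_norm_sq, L2.inner_def]
    refine integral_congr_ae ?_
    filter_upwards [TT_coe hU (e i)] with z hz
    rw [hz]; simp [sq]
  have hint : ∀ i, Integrable (fun z => (Tf hU (e i) z) ^ 2) mu := by
    intro i
    refine Integrable.of_bound ((Tf_meas hU (e i)).pow_const 2).aestronglyMeasurable
      (‖e i‖ ^ 2) (Filter.Eventually.of_forall fun z => ?_)
    rw [norm_pow]
    exact pow_le_pow_left₀ (norm_nonneg _) (Tf_bdd hU (e i) z) 2
  simp_rw [h1]
  rw [← integral_finsetSum _ fun i _ => hint i]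
  have : ∫ z, ∑ i, (Tf hU (e i) z) ^ 2 ∂mu ≤ ∫ z, (1 : ℝ) ∂mu := by
    refine integral_mono (integrable_finsetSum _ fun i _ => hint i) (integrable_const _) ?_
    intro z
    have hb := he.sum_inner_products_le (row hU.transpose z) (s := Finset.univ)
    have hn := norm_row hU.transpose z
    have : ∑ i, (Tf hU (e i) z) ^ 2 ≤ ‖row hU.transpose z‖ ^ 2 := by
      refine le_trans (le_of_eq ?_) hb
      refine Finset.sum_congr rfl fun i _ => ?_
      simp [Tf]
    exact this.trans (pow_le_one₀ (norm_nonneg _) hn)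
  simpa using this

theorem TT_adj {U : ℝ → ℝ → ℝ} (hU : Ker U) (x : ℝ) (q : HH) :
    inner ℝ q (row (hU.opProd hU.transpose) x) = inner ℝ (TT hU q) (row hU x) := by
  rw [inner_row, inner_row]
  have e : ∫ z, U x z * TT hU q z ∂mu = ∫ z, U x z * ∫ ξ, U ξ z * q ξ ∂mu ∂mu := by
    refine integral_congr_ae ?_
    filter_upwards [TT_coe hU q] with z hz
    rw [hz, Tf_eq]
  rw [e]
  simp only [opProd, transposeKernel]
  simp_rw [← integral_const_mul, ← integral_mul_const]
  rw [integral_integral_swap]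
  · simp_rw [mul_assoc]
  · have hq : Integrable q mu := (Lp.memLp q).integrable (by norm_num)
    have hq2 : Integrable (fun p : ℝ × ℝ => q p.1) (mu.prod mu) := hq.comp_fst mu
    have h : Measurable (fun p : ℝ × ℝ => U x p.2 * U p.1 p.2) :=
      ((hU.left x).comp measurable_snd).mul hU.meas
    exact hq2.bdd_mul (c := 1) h.aestronglyMeasurable
      (Filter.Eventually.of_forall fun p => abs_mul_le_one' (hU.bdd _ _) (hU.bdd _ _))

theorem TT_row {U : ℝ → ℝ → ℝ} (hU : Ker U) (x : ℝ) :
    TT hU (row (hU.opProd hU.transpose) x) = row ((hU.opProd hU.transpose).opProd hU) x := by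
  apply Lp.ext
  filter_upwards [TT_coe hU (row (hU.opProd hU.transpose) x),
    row_coe ((hU.opProd hU.transpose).opProd hU) x] with z h1 h2
  rw [h1, h2, Tf_eq]
  refine integral_congr_ae ?_
  filter_upwards [row_coe (hU.opProd hU.transpose) x] with ξ h
  rw [h, mul_comm]

theorem inner_row_meas {A : ℝ → ℝ → ℝ} (hA : Ker A) (b : HH) :
    Measurable fun x => inner ℝ b (row hA x) := by
  simp_rw [inner_row]
  have h : Measurable (fun p : ℝ × ℝ => A p.1 p.2 * b p.2) :=
    hA.meas.mul ((Lp.stronglyMeasurable b).measurable.comp measurable_snd)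
  exact (h.stronglyMeasurable.integral_prod_right' (ν := mu)).measurable

theorem inner_row_row {A : ℝ → ℝ → ℝ} (hA : Ker A) (x y : ℝ) :
    inner ℝ (row hA x) (row hA y) = opProd A (transposeKernel A) x y := by
  rw [inner_row]
  refine integral_congr_ae ?_
  filter_upwards [row_coe hA x] with z hz
  rw [hz, mul_comm]; rfl

theorem sixth_eq {U : ℝ → ℝ → ℝ} (hU : Ker U) :
    opProd (opProd (opProd U (transposeKernel U)) U)
      (transposeKernel (opProd (opProd U (transposeKernel U)) U)) = sixthPower U := by
  have hT := hU.transpose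
  have e : transposeKernel (opProd (opProd U (transposeKernel U)) U) =
      opProd (transposeKernel U) (opProd U (transposeKernel U)) := by
    rw [transpose_opProd, transpose_opProd]; rfl
  rw [e, opProd_assoc (hU.opProd hT) hU (hT.opProd (hU.opProd hT)),
    opProd_assoc hU hT (hU.opProd (hT.opProd (hU.opProd hT)))]
  rfl

theorem opProd_congr {A B A' B' : ℝ → ℝ → ℝ}
    (hA : ∀ x ∈ Icc (0:ℝ) 1, ∀ y ∈ Icc (0:ℝ) 1, A x y = A' x y)
    (hB : ∀ x ∈ Icc (0:ℝ) 1, ∀ y ∈ Icc (0:ℝ) 1, B x y = B' x y) :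
    ∀ x ∈ Icc (0:ℝ) 1, ∀ y ∈ Icc (0:ℝ) 1, opProd A B x y = opProd A' B' x y := by
  intro x hx y hy
  refine setIntegral_congr_fun measurableSet_Icc fun z hz => ?_
  simp only [hA x hx z hz, hB z hz y hy]

theorem sixth_congr {A A' : ℝ → ℝ → ℝ}
    (hA : ∀ x ∈ Icc (0:ℝ) 1, ∀ y ∈ Icc (0:ℝ) 1, A x y = A' x y) :
    ∀ x ∈ Icc (0:ℝ) 1, ∀ y ∈ Icc (0:ℝ) 1, sixthPower A x y = sixthPower A' x y := by
  have hT : ∀ x ∈ Icc (0:ℝ) 1, ∀ y ∈ Icc (0:ℝ) 1,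
    transposeKernel A x y = transposeKernel A' x y := fun x hx y hy => hA y hy x hx
  exact opProd_congr hA (opProd_congr hT (opProd_congr hA (opProd_congr hT (opProd_congr hA hT))))

/-- Weak regularity lemma for graphons. -/
theorem stmt_1 (W : ℝ → ℝ → ℝ) (hmeas : Measurable (Function.uncurry W))
    (hrange : ∀ x ∈ Set.Icc (0 : ℝ) 1, ∀ y ∈ Set.Icc (0 : ℝ) 1, W x y ∈ Set.Icc (0 : ℝ) 1)
    (ε : ℝ) (hε : 0 < ε) (hε1 : ε ≤ 1) :
    ∃ n : ℕ, (n : ℝ) ≤ (5 / ε ^ 3) ^ ((1 : ℝ) / ε ^ 2) ∧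
      ∃ V : Fin n → Set ℝ, (∀ i, MeasurableSet (V i)) ∧
        Pairwise (Function.onFun Disjoint V) ∧ (⋃ i, V i) = Set.Icc (0 : ℝ) 1 ∧
        ∃ c : Fin n → Fin n → ℝ, ∀ i j,
          ∀ᵐ p : ℝ × ℝ ∂(volume.restrict ((V i) ×ˢ (V j))),
            |sixthPower W p.1 p.2 - c i j| ≤ 2 * ε ^ 2 := by
  classical
  let U : ℝ → ℝ → ℝ := fun x y => max 0 (min 1 (W x y))
  have hU : Ker U := by
    constructor
    · exact measurable_const.max (measurable_const.min hmeas)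
    · intro x y
      rw [abs_of_nonneg (le_max_left _ _)]
      exact max_le zero_le_one (min_le_left _ _)
  have hUW : ∀ x ∈ Icc (0:ℝ) 1, ∀ y ∈ Icc (0:ℝ) 1, W x y = U x y := by
    intro x hx y hy
    have h := hrange x hx y hy
    simp only [U]
    rw [min_eq_right h.2, max_eq_right h.1]
  obtain ⟨K, hKf, hKr, hK⟩ := abs_lemma (TT hU) (TT_trace hU) (ε ^ 2) (by positivity)
  have hG := (hU.opProd hU.transpose).opProd hU
  obtain ⟨n, hn, V, hVm, hVd, hVu, c, hc⟩ := cell_lemma (row hG) (norm_row hG)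
    (inner_row_meas hG) ε hε hε1 K hKr (fun x => by
      have := hK _ (row hU x) (norm_row hU x) (TT_adj hU x)
      rwa [TT_row] at this)
  refine ⟨n, hn, V, hVm, hVd, hVu, c, fun i j => ?_⟩
  refine (ae_restrict_iff' ((hVm i).prod (hVm j))).mpr (Filter.Eventually.of_forall ?_)
  rintro ⟨x, y⟩ ⟨hx, hy⟩
  have hxI : x ∈ Icc (0:ℝ) 1 := hVu ▸ mem_iUnion_of_mem i hx
  have hyI : y ∈ Icc (0:ℝ) 1 := hVu ▸ mem_iUnion_of_mem j hy
  have h := hc i j x hx y hy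
  rw [inner_row_row, sixth_eq hU] at h
  rw [sixth_congr hUW x hxI y hyI]
  exact h
end

section
/- Every sequence (W_n) of graphons has a subsequence (W_{n_k}) and a graphon W such that δ_□(W_{n_k}, W) → 0 as k → ∞; that is, the space of graphons with the cut distance δ_□ is sequentially compact. -/
open MeasureTheory Set

/-- The cut norm of a kernel: the supremum of `|∫_{S×T} W|` over measurable
`S, T ⊆ [0,1]`. -/
noncomputable def cutNorm (W : ℝ → ℝ → ℝ) : ℝ :=
  sSup { r : ℝ | ∃ S T : Set ℝ, MeasurableSet S ∧ MeasurableSet T ∧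
    S ⊆ Set.Icc 0 1 ∧ T ⊆ Set.Icc 0 1 ∧
    r = |∫ p in S ×ˢ T, W p.1 p.2| }

/-- An invertible measure-preserving map of `[0,1]`: a measurable map of `[0,1]` to
itself, preserving Lebesgue measure, with a measurable inverse on `[0,1]`. -/
def IsInvMeasurePres (φ : ℝ → ℝ) : Prop :=
  Measurable φ ∧ Set.MapsTo φ (Set.Icc 0 1) (Set.Icc 0 1) ∧
  MeasurePreserving φ (volume.restrict (Set.Icc (0:ℝ) 1)) (volume.restrict (Set.Icc (0:ℝ) 1)) ∧
  ∃ ψ : ℝ → ℝ, Measurable ψ ∧ Set.MapsTo ψ (Set.Icc 0 1) (Set.Icc 0 1) ∧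
    Set.InvOn ψ φ (Set.Icc 0 1) (Set.Icc 0 1)

/-- The cut distance `δ_□(U, W) = inf_{φ,ψ} ‖U − W^{φ,ψ}‖_□` over invertible
measure-preserving maps `φ, ψ` of `[0,1]`. -/
noncomputable def cutDist (U W : ℝ → ℝ → ℝ) : ℝ :=
  sInf { r : ℝ | ∃ φ ψ : ℝ → ℝ, IsInvMeasurePres φ ∧ IsInvMeasurePres ψ ∧
    r = cutNorm (fun x y => U x y - W (φ x) (ψ y)) }


abbrev cI : Set ℝ := Set.Icc (0:ℝ) 1

noncomputable abbrev cmu : Measure ℝ := volume.restrict cI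

def GKer (f : ℝ → ℝ → ℝ) : Prop := IntegrableOn (Function.uncurry f) (cI ×ˢ cI)

lemma cmu_prod : cmu.prod cmu = volume.restrict (cI ×ˢ cI) := by
  rw [Measure.prod_restrict]; rfl

lemma cutNorm_le {f : ℝ → ℝ → ℝ} {C : ℝ}
    (h : ∀ S T : Set ℝ, MeasurableSet S → MeasurableSet T → S ⊆ cI → T ⊆ cI →
      |∫ p in S ×ˢ T, f p.1 p.2| ≤ C) : cutNorm f ≤ C := by
  apply csSup_le
  · exact ⟨_, ∅, ∅, MeasurableSet.empty, MeasurableSet.empty, by simp, by simp, rfl⟩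
  · rintro r ⟨S, T, hS, hT, hSI, hTI, rfl⟩
    exact h S T hS hT hSI hTI

lemma abs_int_le {f : ℝ → ℝ → ℝ} (hf : GKer f) {S T : Set ℝ} (hSI : S ⊆ cI) (hTI : T ⊆ cI) :
    |∫ p in S ×ˢ T, f p.1 p.2| ≤ ∫ p in cI ×ˢ cI, |f p.1 p.2| := by
  refine (abs_integral_le_integral_abs).trans ?_
  refine setIntegral_mono_set (f := fun p : ℝ × ℝ => |f p.1 p.2|) ?_ ?_ ?_
  · exact hf.abs
  · exact Filter.Eventually.of_forall fun p => abs_nonneg _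
  · exact (Set.prod_mono hSI hTI).eventuallyLE

lemma le_cutNorm {f : ℝ → ℝ → ℝ} (hf : GKer f) {S T : Set ℝ} (hS : MeasurableSet S)
    (hT : MeasurableSet T) (hSI : S ⊆ cI) (hTI : T ⊆ cI) :
    |∫ p in S ×ˢ T, f p.1 p.2| ≤ cutNorm f := by
  apply le_csSup
  · refine ⟨∫ p in cI ×ˢ cI, |f p.1 p.2|, ?_⟩
    rintro r ⟨S, T, hS, hT, hSI, hTI, rfl⟩
    exact abs_int_le hf hSI hTI
  · exact ⟨S, T, hS, hT, hSI, hTI, rfl⟩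

lemma cutNorm_nonneg (f : ℝ → ℝ → ℝ) : 0 ≤ cutNorm f := by
  apply Real.sSup_nonneg
  rintro r ⟨S, T, hS, hT, hSI, hTI, rfl⟩
  positivity

lemma cutNorm_le_integral {f : ℝ → ℝ → ℝ} (hf : GKer f) :
    cutNorm f ≤ ∫ p in cI ×ˢ cI, |f p.1 p.2| :=
  cutNorm_le fun _ _ _ _ hSI hTI => abs_int_le hf hSI hTI

lemma cutNorm_congr {f g : ℝ → ℝ → ℝ} (h : ∀ x ∈ cI, ∀ y ∈ cI, f x y = g x y) :
    cutNorm f = cutNorm g := by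
  have key : ∀ S T : Set ℝ, MeasurableSet S → MeasurableSet T → S ⊆ cI → T ⊆ cI →
      ∫ p in S ×ˢ T, f p.1 p.2 = ∫ p in S ×ˢ T, g p.1 p.2 := by
    intro S T hS hT hSI hTI
    apply setIntegral_congr_fun (hS.prod hT)
    rintro ⟨x, y⟩ ⟨hx, hy⟩
    exact h x (hSI hx) y (hTI hy)
  unfold cutNorm
  congr 1
  ext r
  constructor
  · rintro ⟨S, T, hS, hT, hSI, hTI, rfl⟩
    exact ⟨S, T, hS, hT, hSI, hTI, by rw [key S T hS hT hSI hTI]⟩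
  · rintro ⟨S, T, hS, hT, hSI, hTI, rfl⟩
    exact ⟨S, T, hS, hT, hSI, hTI, by rw [key S T hS hT hSI hTI]⟩

lemma cutNorm_neg (f : ℝ → ℝ → ℝ) : cutNorm (fun x y => - f x y) = cutNorm f := by
  unfold cutNorm
  simp only [integral_neg, abs_neg]

lemma cutNorm_add_le {f g : ℝ → ℝ → ℝ} (hf : GKer f) (hg : GKer g) :
    cutNorm (fun x y => f x y + g x y) ≤ cutNorm f + cutNorm g := by
  apply cutNorm_le
  intro S T hS hT hSI hTI
  have h1 : IntegrableOn (Function.uncurry f) (S ×ˢ T) := hf.mono_set (Set.prod_mono hSI hTI)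
  have h2 : IntegrableOn (Function.uncurry g) (S ×ˢ T) := hg.mono_set (Set.prod_mono hSI hTI)
  have := integral_add h1 h2
  simp only [Function.uncurry] at this
  rw [this]
  exact (abs_add_le _ _).trans (add_le_add (le_cutNorm hf hS hT hSI hTI) (le_cutNorm hg hS hT hSI hTI))

lemma GKer.add {f g : ℝ → ℝ → ℝ} (hf : GKer f) (hg : GKer g) :
    GKer (fun x y => f x y + g x y) := Integrable.add hf hg

lemma GKer.sub {f g : ℝ → ℝ → ℝ} (hf : GKer f) (hg : GKer g) :
    GKer (fun x y => f x y - g x y) := Integrable.sub hf hg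

lemma IsInvMeasurePres.prodmp {φ ψ : ℝ → ℝ} (hφ : IsInvMeasurePres φ) (hψ : IsInvMeasurePres ψ) :
    MeasurePreserving (Prod.map φ ψ) (volume.restrict (cI ×ˢ cI)) (volume.restrict (cI ×ˢ cI)) := by
  rw [← cmu_prod]
  exact hφ.2.2.1.prod hψ.2.2.1

lemma GKer.comp {f : ℝ → ℝ → ℝ} (hf : GKer f) {φ ψ : ℝ → ℝ}
    (hφ : IsInvMeasurePres φ) (hψ : IsInvMeasurePres ψ) :
    GKer (fun x y => f (φ x) (ψ y)) :=
  (hφ.prodmp hψ).integrable_comp_of_integrable hf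

lemma cutNorm_comp_le {f : ℝ → ℝ → ℝ} (hf : GKer f) {φ ψ : ℝ → ℝ}
    (hφ : IsInvMeasurePres φ) (hψ : IsInvMeasurePres ψ) :
    cutNorm (fun x y => f (φ x) (ψ y)) ≤ cutNorm f := by
  apply cutNorm_le
  intro S T hS hT hSI hTI
  obtain ⟨φ', hφ'm, hφ'I, hφ'inv⟩ := hφ.2.2.2
  obtain ⟨ψ', hψ'm, hψ'I, hψ'inv⟩ := hψ.2.2.2
  have e : ∫ p in S ×ˢ T, f (φ p.1) (ψ p.2) =
      ∫ p in (cI ∩ φ' ⁻¹' S) ×ˢ (cI ∩ ψ' ⁻¹' T), f p.1 p.2 := by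
    have hS2 : MeasurableSet (cI ∩ φ' ⁻¹' S) := measurableSet_Icc.inter (hφ'm hS)
    have hT2 : MeasurableSet (cI ∩ ψ' ⁻¹' T) := measurableSet_Icc.inter (hψ'm hT)
    rw [← integral_indicator (hS.prod hT), ← integral_indicator (hS2.prod hT2)]
    rw [← setIntegral_eq_integral_of_forall_compl_eq_zero (s := cI ×ˢ cI)
      (f := (S ×ˢ T).indicator fun p : ℝ × ℝ => f (φ p.1) (ψ p.2)),
      ← setIntegral_eq_integral_of_forall_compl_eq_zero (s := cI ×ˢ cI)
      (f := ((cI ∩ φ' ⁻¹' S) ×ˢ (cI ∩ ψ' ⁻¹' T)).indicator fun p : ℝ × ℝ => f p.1 p.2)]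
    · set F := ((cI ∩ φ' ⁻¹' S) ×ˢ (cI ∩ ψ' ⁻¹' T)).indicator (fun p : ℝ × ℝ => f p.1 p.2) with hF
      have hFm : AEStronglyMeasurable F (volume.restrict (cI ×ˢ cI)) :=
        (AEStronglyMeasurable.indicator hf.aestronglyMeasurable (hS2.prod hT2))
      have := (hφ.prodmp hψ).map_eq
      conv_rhs => rw [← this]
      rw [integral_map (hφ.prodmp hψ).aemeasurable (by rw [this]; exact hFm)]
      apply setIntegral_congr_fun (measurableSet_Icc.prod measurableSet_Icc)
      rintro ⟨x, y⟩ ⟨hx, hy⟩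
      have hx' : φ x ∈ cI := hφ.2.1 hx
      have hy' : ψ y ∈ cI := hψ.2.1 hy
      have e1 : φ' (φ x) = x := hφ'inv.1 hx
      have e2 : ψ' (ψ y) = y := hψ'inv.1 hy
      change (S ×ˢ T).indicator (fun p : ℝ × ℝ => f (φ p.1) (ψ p.2)) (x, y) = F (φ x, ψ y)
      by_cases hp : x ∈ S ∧ y ∈ T
      · rw [hF, Set.indicator_of_mem (show (x, y) ∈ S ×ˢ T from hp), Set.indicator_of_mem]
        exact ⟨⟨hx', by simpa only [Set.mem_preimage, e1] using hp.1⟩,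
            ⟨hy', by simpa only [Set.mem_preimage, e2] using hp.2⟩⟩
      · rw [hF, Set.indicator_of_notMem (show (x, y) ∉ S ×ˢ T from hp), Set.indicator_of_notMem]
        intro h
        apply hp
        have h1 : φ' (φ x) ∈ S := h.1.2
        have h2 : ψ' (ψ y) ∈ T := h.2.2
        rw [e1] at h1
        rw [e2] at h2
        exact ⟨h1, h2⟩
    · rintro p hp
      apply Set.indicator_of_notMem
      exact fun h => hp ⟨h.1.1, h.2.1⟩
    · rintro p hp
      apply Set.indicator_of_notMem
      exact fun h => hp ⟨hSI h.1, hTI h.2⟩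
  rw [e]
  exact le_cutNorm hf (measurableSet_Icc.inter (hφ'm hS)) (measurableSet_Icc.inter (hψ'm hT))
    Set.inter_subset_left Set.inter_subset_left

lemma isInv_id : IsInvMeasurePres (fun x => x) :=
  ⟨measurable_id, fun _ h => h, MeasurePreserving.id _, fun x => x, measurable_id, fun _ h => h,
    fun _ _ => rfl, fun _ _ => rfl⟩

lemma IsInvMeasurePres.comp {φ ψ : ℝ → ℝ} (hφ : IsInvMeasurePres φ) (hψ : IsInvMeasurePres ψ) :
    IsInvMeasurePres (fun x => φ (ψ x)) := by
  obtain ⟨φ', hφ'm, hφ'I, hφ'inv⟩ := hφ.2.2.2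
  obtain ⟨ψ', hψ'm, hψ'I, hψ'inv⟩ := hψ.2.2.2
  refine ⟨hφ.1.comp hψ.1, fun x hx => hφ.2.1 (hψ.2.1 hx), hφ.2.2.1.comp hψ.2.2.1,
    fun x => ψ' (φ' x), hψ'm.comp hφ'm, fun x hx => hψ'I (hφ'I hx), ?_, ?_⟩
  · intro x hx
    have e1 : φ' (φ (ψ x)) = ψ x := hφ'inv.1 (hψ.2.1 hx)
    have e2 : ψ' (ψ x) = x := hψ'inv.1 hx
    simp only [e1, e2]
  · intro x hx
    have e1 : ψ (ψ' (φ' x)) = φ' x := hψ'inv.2 (hφ'I hx)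
    have e2 : φ (φ' x) = x := hφ'inv.2 hx
    simp only [e1, e2]

lemma IsInvMeasurePres.exists_inv {φ : ℝ → ℝ} (hφ : IsInvMeasurePres φ) :
    ∃ ψ, IsInvMeasurePres ψ ∧ (∀ x ∈ cI, ψ (φ x) = x) ∧ (∀ x ∈ cI, φ (ψ x) = x) := by
  obtain ⟨ψ, hm, hI, hinv⟩ := hφ.2.2.2
  refine ⟨ψ, ⟨hm, hI, ⟨hm, ?_⟩, φ, hφ.1, hφ.2.1, hinv.symm⟩, fun x hx => hinv.1 hx,
    fun x hx => hinv.2 hx⟩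
  conv_lhs => rw [← hφ.2.2.1.map_eq]
  rw [Measure.map_map hm hφ.1]
  have : (ψ ∘ φ) =ᵐ[volume.restrict (Set.Icc (0:ℝ) 1)] _root_.id := by
    filter_upwards [ae_restrict_mem measurableSet_Icc] with x hx
    exact hinv.1 hx
  rw [Measure.map_congr this, Measure.map_id]

lemma cutDist_nonneg (U W : ℝ → ℝ → ℝ) : 0 ≤ cutDist U W := by
  apply Real.sInf_nonneg
  rintro r ⟨φ, ψ, _, _, rfl⟩
  exact cutNorm_nonneg _

lemma cutDist_le (U W : ℝ → ℝ → ℝ) {φ ψ : ℝ → ℝ} (hφ : IsInvMeasurePres φ)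
    (hψ : IsInvMeasurePres ψ) :
    cutDist U W ≤ cutNorm (fun x y => U x y - W (φ x) (ψ y)) := by
  apply csInf_le
  · refine ⟨0, ?_⟩
    rintro r ⟨φ, ψ, _, _, rfl⟩
    exact cutNorm_nonneg _
  · exact ⟨φ, ψ, hφ, hψ, rfl⟩

lemma exists_of_cutDist_lt {U W : ℝ → ℝ → ℝ} {r : ℝ} (h : cutDist U W < r) :
    ∃ φ ψ : ℝ → ℝ, IsInvMeasurePres φ ∧ IsInvMeasurePres ψ ∧
      cutNorm (fun x y => U x y - W (φ x) (ψ y)) < r := by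
  obtain ⟨_, ⟨φ, ψ, h1, h2, rfl⟩, h3⟩ := exists_lt_of_csInf_lt
    (by exact ⟨_, _, _, isInv_id, isInv_id, rfl⟩) h
  exact ⟨φ, ψ, h1, h2, h3⟩

lemma cutDist_self (U : ℝ → ℝ → ℝ) : cutDist U U = 0 := by
  apply le_antisymm _ (cutDist_nonneg _ _)
  refine (cutDist_le U U isInv_id isInv_id).trans ?_
  apply cutNorm_le
  intro S T _ _ _ _
  simp

lemma cutDist_comm_le {U W : ℝ → ℝ → ℝ} (hU : GKer U) (hW : GKer W) :
    cutDist W U ≤ cutDist U W := by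
  apply le_of_forall_gt
  intro r hr
  obtain ⟨φ, ψ, hφ, hψ, h⟩ := exists_of_cutDist_lt hr
  obtain ⟨φ', hφ', -, hφ2⟩ := hφ.exists_inv
  obtain ⟨ψ', hψ', -, hψ2⟩ := hψ.exists_inv
  refine lt_of_le_of_lt ?_ h
  refine (cutDist_le W U hφ' hψ').trans ?_
  have h1 := cutNorm_comp_le (hU.sub (hW.comp hφ hψ)) hφ' hψ'
  refine le_trans (le_of_eq ?_) h1
  rw [← cutNorm_neg]
  apply cutNorm_congr
  intro x hx y hy
  rw [hφ2 x hx, hψ2 y hy]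
  ring

lemma cutDist_triangle {U V W : ℝ → ℝ → ℝ} (hU : GKer U) (hV : GKer V) (hW : GKer W) :
    cutDist U W ≤ cutDist U V + cutDist V W := by
  apply le_of_forall_pos_lt_add
  intro ε hε
  obtain ⟨φ, ψ, hφ, hψ, h⟩ := exists_of_cutDist_lt (lt_add_of_pos_right (cutDist U V) (half_pos hε))
  obtain ⟨φ', ψ', hφ', hψ', h'⟩ :=
    exists_of_cutDist_lt (lt_add_of_pos_right (cutDist V W) (half_pos hε))
  have h1 := cutDist_le U W (hφ'.comp hφ) (hψ'.comp hψ)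
  have h2 := cutNorm_comp_le (hV.sub (hW.comp hφ' hψ')) hφ hψ
  have h3 := cutNorm_add_le (hU.sub (hV.comp hφ hψ)) ((hV.sub (hW.comp hφ' hψ')).comp hφ hψ)
  have h4 : ∀ x y, (U x y - V (φ x) (ψ y) + (V (φ x) (ψ y) - W (φ' (φ x)) (ψ' (ψ y)))) =
    U x y - W (φ' (φ x)) (ψ' (ψ y)) := fun x y => by ring
  simp only [h4] at h3
  linarith

/-- graphons -/
def IsGraphon (W : ℝ → ℝ → ℝ) : Prop :=
  Measurable (Function.uncurry W) ∧
  ∀ x ∈ Set.Icc (0:ℝ) 1, ∀ y ∈ Set.Icc (0:ℝ) 1, W x y ∈ Set.Icc (0:ℝ) 1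

lemma vol_sq : (volume : Measure (ℝ × ℝ)) (cI ×ˢ cI) = 1 := by
  rw [Measure.volume_eq_prod, Measure.prod_prod]; simp

instance cmu_prob : IsProbabilityMeasure cmu := ⟨by simp [cmu, cI]⟩

instance csq_prob : IsProbabilityMeasure ((volume : Measure (ℝ × ℝ)).restrict (cI ×ˢ cI)) :=
  ⟨by rw [Measure.restrict_apply_univ, vol_sq]⟩

lemma gker_of_bound {f : ℝ → ℝ → ℝ} (hf : Measurable (Function.uncurry f)) (C : ℝ)
    (h : ∀ x ∈ cI, ∀ y ∈ cI, |f x y| ≤ C) : GKer f := by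
  refine Integrable.mono' (integrable_const C) hf.aestronglyMeasurable ?_
  filter_upwards [ae_restrict_mem (measurableSet_Icc.prod measurableSet_Icc)] with p hp
  exact h _ hp.1 _ hp.2

lemma IsGraphon.gker {W : ℝ → ℝ → ℝ} (h : IsGraphon W) : GKer W :=
  gker_of_bound h.1 1 fun x hx y hy => by
    have := h.2 x hx y hy
    rw [abs_of_nonneg this.1]; exact this.2

lemma IsGraphon.comp {W : ℝ → ℝ → ℝ} (h : IsGraphon W) {φ ψ : ℝ → ℝ} (hφ : IsInvMeasurePres φ)
    (hψ : IsInvMeasurePres ψ) : IsGraphon (fun x y => W (φ x) (ψ y)) :=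
  ⟨h.1.comp (hφ.1.prodMap hψ.1), fun _ hx _ hy => h.2 _ (hφ.2.1 hx) _ (hψ.2.1 hy)⟩

/-- the type of graphons -/
def Graphon : Type := {W : ℝ → ℝ → ℝ // IsGraphon W}

noncomputable instance graphonMetric : PseudoMetricSpace Graphon where
  dist U W := cutDist U.1 W.1
  dist_self U := cutDist_self _
  dist_comm U W := le_antisymm (cutDist_comm_le W.2.gker U.2.gker)
    (cutDist_comm_le U.2.gker W.2.gker)
  dist_triangle U V W := cutDist_triangle U.2.gker V.2.gker W.2.gker

lemma weak_limit (v : ℕ → ℝ → ℝ → ℝ) (hv : ∀ n, IsGraphon (v n)) :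
    ∃ L : ℝ → ℝ → ℝ, IsGraphon L ∧ ∃ F : Filter ℕ, F.NeBot ∧ F ≤ Filter.atTop ∧
      ∀ S T : Set ℝ, MeasurableSet S → MeasurableSet T → S ⊆ cI → T ⊆ cI →
      Filter.Tendsto (fun n => ∫ p in S ×ˢ T, v n p.1 p.2) F
        (nhds (∫ p in S ×ˢ T, L p.1 p.2)) := by
  set ν : Measure (ℝ × ℝ) := (volume : Measure (ℝ × ℝ)).restrict (cI ×ˢ cI) with hν
  have hQ : MeasurableSet (cI ×ˢ cI) := measurableSet_Icc.prod measurableSet_Icc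
  have hbd : ∀ n, ∀ᵐ p ∂ν, 0 ≤ v n p.1 p.2 ∧ v n p.1 p.2 ≤ 1 := by
    intro n
    filter_upwards [ae_restrict_mem hQ] with p hp
    exact (hv n).2 _ hp.1 _ hp.2
  have hmem : ∀ n, MemLp (Function.uncurry (v n)) 2 ν := by
    intro n
    refine MemLp.of_bound (hv n).1.aestronglyMeasurable 1 ?_
    filter_upwards [hbd n] with p hp
    rw [Real.norm_eq_abs, Function.uncurry, abs_of_nonneg hp.1]
    exact hp.2
  set e : ℕ → Lp ℝ 2 ν := fun n => (hmem n).toLp _ with he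
  have hnorm : ∀ n, ‖e n‖ ≤ 1 := by
    intro n
    have := Lp.norm_le_of_ae_bound (f := e n) (C := 1) zero_le_one (by
      filter_upwards [hbd n, (hmem n).coeFn_toLp] with p hp h2
      rw [he]; simp only
      rw [h2, Real.norm_eq_abs, Function.uncurry, abs_of_nonneg hp.1]
      exact hp.2)
    simpa [measureUnivNNReal] using this
  set D : ℕ → WeakDual ℝ (Lp ℝ 2 ν) := fun n =>
    StrongDual.toWeakDual (InnerProductSpace.toDual ℝ (Lp ℝ 2 ν) (e n)) with hD
  have hcomp := WeakDual.isCompact_closedBall (𝕜 := ℝ) (E := Lp ℝ 2 ν) 0 1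
  set 𝒰 : Ultrafilter ℕ := Ultrafilter.of Filter.atTop with h𝒰
  have hle := hcomp.ultrafilter_le_nhds (𝒰.map D) (by
    rw [Filter.le_principal_iff]
    refine Filter.mem_map.2 (Filter.Eventually.of_forall (fun n => ?_))
    simp only [Set.mem_preimage, Metric.mem_closedBall, dist_zero_right]
    change ‖InnerProductSpace.toDual ℝ (Lp ℝ 2 ν) (e n)‖ ≤ 1
    rw [LinearIsometryEquiv.norm_map]
    exact hnorm n)
  obtain ⟨Λ, -, hΛ⟩ := hle
  set l : Lp ℝ 2 ν := (InnerProductSpace.toDual ℝ (Lp ℝ 2 ν)).symm (WeakDual.toStrongDual Λ) with hl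
  have hconv : ∀ g : Lp ℝ 2 ν, Filter.Tendsto (fun n => inner ℝ (e n) g) 𝒰 (nhds (inner ℝ l g)) := by
    intro g
    have h1 : Filter.Tendsto (fun Γ : WeakDual ℝ (Lp ℝ 2 ν) => Γ g) (nhds Λ) (nhds (Λ g)) :=
      (WeakDual.eval_continuous g).tendsto Λ
    have h2 : Filter.Tendsto D 𝒰 (nhds Λ) := hΛ
    have h3 := h1.comp h2
    have h4 : inner ℝ l g = Λ g := by
      rw [hl, InnerProductSpace.toDual_symm_apply]; rfl
    rw [h4]
    refine h3.congr (fun n => ?_)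
    simp only [Function.comp, hD]
    change InnerProductSpace.toDual ℝ (Lp ℝ 2 ν) (e n) g = _
    rw [InnerProductSpace.toDual_apply_apply]
  have hset : ∀ A : Set (ℝ × ℝ), MeasurableSet A →
      Filter.Tendsto (fun n => ∫ p in A, v n p.1 p.2 ∂ν) 𝒰 (nhds (∫ p in A, l p ∂ν)) := by
    intro A hA
    have hAf : ν A ≠ ⊤ := measure_ne_top _ _
    have h1 := hconv (indicatorConstLp 2 hA hAf (1:ℝ))
    rw [real_inner_comm, L2.inner_indicatorConstLp_one (𝕜 := ℝ) hA hAf l] at h1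
    refine h1.congr (fun n => ?_)
    rw [real_inner_comm, L2.inner_indicatorConstLp_one (𝕜 := ℝ) hA hAf (e n)]
    apply setIntegral_congr_ae hA
    filter_upwards [(hmem n).coeFn_toLp] with p hp _
    exact hp
  have hlint : Integrable l ν := (Lp.memLp l).integrable (by norm_num)
  have hge : 0 ≤ᵐ[ν] l := by
    apply ae_nonneg_of_forall_setIntegral_nonneg hlint
    intro A hA _
    refine ge_of_tendsto' (hset A hA) (fun n => ?_)
    apply setIntegral_nonneg_of_ae
    filter_upwards [hbd n] with p hp
    exact hp.1
  have hle1 : l ≤ᵐ[ν] fun _ => (1:ℝ) := by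
    apply ae_le_of_forall_setIntegral_le hlint (integrable_const _)
    intro A hA _
    refine le_of_tendsto' (hset A hA) (fun n => ?_)
    apply setIntegral_mono_ae
    · exact ((hmem n).integrable (by norm_num)).integrableOn
    · exact (integrable_const _).integrableOn
    · filter_upwards [hbd n] with p hp
      exact hp.2
  have hlm : StronglyMeasurable l := Lp.stronglyMeasurable l
  refine ⟨fun x y => max 0 (min 1 (l (x, y))), ⟨?_, ?_⟩, 𝒰, inferInstance, ?_, ?_⟩
  · exact measurable_const.max (measurable_const.min hlm.measurable)
  · intro x _ y _
    exact ⟨le_max_left _ _, max_le zero_le_one (min_le_left _ _)⟩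
  · exact Ultrafilter.of_le _
  · intro S T hS hT hSI hTI
    have h1 := hset (S ×ˢ T) (hS.prod hT)
    have h2 : ν.restrict (S ×ˢ T) = volume.restrict (S ×ˢ T) := by
      rw [hν, Measure.restrict_restrict (hS.prod hT), Set.inter_eq_left.2 (Set.prod_mono hSI hTI)]
    have h3 : ∫ p in S ×ˢ T, max 0 (min 1 (l (p.1, p.2))) = ∫ p in S ×ˢ T, l p ∂ν := by
      rw [← h2]
      apply integral_congr_ae
      apply ae_restrict_of_ae
      filter_upwards [hge, hle1] with p hp hp2
      rw [Prod.mk.eta, min_eq_right hp2, max_eq_right (show (0:ℝ) ≤ l p from hp)]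
    rw [h3]
    rw [h2] at h1
    rwa [h2]

lemma graphon_complete : CompleteSpace Graphon := by
  refine Metric.complete_of_convergent_controlled_sequences (fun n => (1/2:ℝ)^n) (fun n => by positivity) ?_
  intro u hu
  have h1 : ∀ n, ∃ q : (ℝ → ℝ) × (ℝ → ℝ), IsInvMeasurePres q.1 ∧ IsInvMeasurePres q.2 ∧
      cutNorm (fun x y => (u n).1 x y - (u (n+1)).1 (q.1 x) (q.2 y)) < (1/2:ℝ)^n := by
    intro n
    obtain ⟨φ, ψ, h1, h2, h3⟩ := exists_of_cutDist_lt (hu n n (n+1) le_rfl (Nat.le_succ n))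
    exact ⟨(φ, ψ), h1, h2, h3⟩
  choose q hq1 hq2 hq3 using h1
  let Φ : ℕ → (ℝ → ℝ) := fun n => Nat.rec (fun x => x) (fun n f => fun x => (q n).1 (f x)) n
  let Ψ : ℕ → (ℝ → ℝ) := fun n => Nat.rec (fun x => x) (fun n f => fun x => (q n).2 (f x)) n
  have hΦ : ∀ n, IsInvMeasurePres (Φ n) := by
    intro n
    induction n with
    | zero => exact isInv_id
    | succ n ih => exact (hq1 n).comp ih
  have hΨ : ∀ n, IsInvMeasurePres (Ψ n) := by
    intro n
    induction n with
    | zero => exact isInv_id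
    | succ n ih => exact (hq2 n).comp ih
  let v : ℕ → ℝ → ℝ → ℝ := fun n x y => (u n).1 (Φ n x) (Ψ n y)
  have hv : ∀ n, IsGraphon (v n) := fun n => (u n).2.comp (hΦ n) (hΨ n)
  have hstep : ∀ n, cutNorm (fun x y => v n x y - v (n+1) x y) ≤ (1/2:ℝ)^n := fun n =>
    (cutNorm_comp_le ((u n).2.gker.sub ((u (n+1)).2.gker.comp (hq1 n) (hq2 n))) (hΦ n) (hΨ n)).trans
      (hq3 n).le
  have hmany : ∀ n k, cutNorm (fun x y => v n x y - v (n+k) x y) ≤ 2 * (1/2:ℝ)^n - 2 * (1/2:ℝ)^(n+k) := by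
    intro n k
    induction k with
    | zero =>
      simp only [add_zero, sub_self]
      exact cutNorm_le (fun S T _ _ _ _ => by simp)
    | succ k ih =>
      have h3 := cutNorm_add_le ((hv n).gker.sub (hv (n+k)).gker) ((hv (n+k)).gker.sub (hv (n+k+1)).gker)
      have h4 : ∀ x y, (v n x y - v (n+k) x y) + (v (n+k) x y - v (n+k+1) x y) =
        v n x y - v (n+k+1) x y := fun x y => by ring
      simp only [h4] at h3
      have := hstep (n+k)
      have e : (1/2:ℝ)^(n+k+1) = (1/2:ℝ)^(n+k) / 2 := by rw [pow_succ]; ring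
      rw [← add_assoc, e]
      linarith
  obtain ⟨L, hL, F, hF, hFle, hlim⟩ := weak_limit v hv
  have hvL : ∀ n, cutNorm (fun x y => v n x y - L x y) ≤ 2 * (1/2:ℝ)^n := by
    intro n
    apply cutNorm_le
    intro S T hS hT hSI hTI
    have hsub : ∀ (f : ℝ → ℝ → ℝ), GKer f → ∫ p in S ×ˢ T, (v n p.1 p.2 - f p.1 p.2) =
        (∫ p in S ×ˢ T, v n p.1 p.2) - ∫ p in S ×ˢ T, f p.1 p.2 := by
      intro f hf
      exact integral_sub ((hv n).gker.mono_set (Set.prod_mono hSI hTI)) (hf.mono_set (Set.prod_mono hSI hTI))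
    rw [hsub L hL.gker]
    have h5 := ((tendsto_const_nhds (x := ∫ p in S ×ˢ T, v n p.1 p.2)).sub (hlim S T hS hT hSI hTI)).abs
    refine le_of_tendsto h5 ?_
    filter_upwards [hFle (Filter.eventually_ge_atTop n)] with m hm
    obtain ⟨k, rfl⟩ := Nat.exists_eq_add_of_le hm
    rw [← hsub _ (hv (n+k)).gker]
    refine (le_cutNorm ((hv n).gker.sub (hv (n+k)).gker) hS hT hSI hTI).trans ((hmany n k).trans ?_)
    have : (0:ℝ) < (1/2:ℝ)^(n+k) := by positivity
    linarith
  obtain ⟨Lg, hLg⟩ : ∃ Lg : Graphon, Lg.1 = L := ⟨⟨L, hL⟩, rfl⟩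
  refine ⟨Lg, ?_⟩
  rw [tendsto_iff_dist_tendsto_zero]
  have hz : Filter.Tendsto (fun n : ℕ => 2 * (1/2:ℝ)^n) Filter.atTop (nhds 0) := by
    have := (tendsto_pow_atTop_nhds_zero_of_lt_one (r := (1/2:ℝ)) (by norm_num) (by norm_num)).const_mul 2
    simpa using this
  refine squeeze_zero (fun n => dist_nonneg) (fun n => ?_) hz
  rw [dist_comm]
  change cutDist Lg.1 (u n).1 ≤ _
  rw [hLg]
  refine (cutDist_le L (u n).1 (hΦ n) (hΨ n)).trans ?_
  rw [← cutNorm_neg]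
  refine le_trans (le_of_eq ?_) (hvL n)
  congr 1
  ext x y
  simp only [v]
  ring

/-- a combination of `n` rectangles with coefficients `0, ε, -ε` -/
noncomputable def stepU (ε : ℝ) (n : ℕ) (s : ℕ → SignType) (S T : ℕ → Set ℝ) (x y : ℝ) : ℝ :=
  ε * ∑ i ∈ Finset.range n, (s i : ℝ) * ((S i).indicator 1 x * (T i).indicator 1 y)

lemma ind_meas {S : Set ℝ} (hS : MeasurableSet S) : Measurable (S.indicator (1 : ℝ → ℝ)) :=
  measurable_one.indicator hS

lemma ind_abs (S : Set ℝ) (x : ℝ) : |S.indicator (1 : ℝ → ℝ) x| ≤ 1 := by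
  by_cases h : x ∈ S <;> simp [h]

lemma sign_abs (s : SignType) : |(s : ℝ)| ≤ 1 := by
  cases s <;> simp

lemma stepU_meas (ε : ℝ) (n : ℕ) (s : ℕ → SignType) {S T : ℕ → Set ℝ}
    (hS : ∀ i, MeasurableSet (S i)) (hT : ∀ i, MeasurableSet (T i)) :
    Measurable (Function.uncurry (stepU ε n s S T)) := by
  unfold stepU Function.uncurry
  apply Measurable.const_mul
  apply Finset.measurable_sum
  intro i _
  apply Measurable.const_mul
  exact ((ind_meas (hS i)).comp measurable_fst).mul ((ind_meas (hT i)).comp measurable_snd)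

lemma stepU_abs (ε : ℝ) (hε : 0 ≤ ε) (n : ℕ) (s : ℕ → SignType) (S T : ℕ → Set ℝ) (x y : ℝ) :
    |stepU ε n s S T x y| ≤ ε * n := by
  unfold stepU
  rw [abs_mul, abs_of_nonneg hε]
  gcongr
  refine (Finset.abs_sum_le_sum_abs _ _).trans ?_
  refine (Finset.sum_le_card_nsmul _ _ 1 ?_).trans (by simp)
  intro i _
  rw [abs_mul, abs_mul]
  exact mul_le_one₀ (sign_abs _) (by positivity) (mul_le_one₀ (ind_abs _ _) (by positivity) (ind_abs _ _))

lemma stepU_gker (ε : ℝ) (hε : 0 ≤ ε) (n : ℕ) (s : ℕ → SignType) {S T : ℕ → Set ℝ}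
    (hS : ∀ i, MeasurableSet (S i)) (hT : ∀ i, MeasurableSet (T i)) : GKer (stepU ε n s S T) :=
  gker_of_bound (stepU_meas ε n s hS hT) (ε * n) fun x _ y _ => stepU_abs ε hε n s S T x y

lemma energy_step {D : ℝ → ℝ → ℝ} (hD : Measurable (Function.uncurry D)) {C : ℝ}
    (hC : ∀ x ∈ cI, ∀ y ∈ cI, |D x y| ≤ C) {ε : ℝ} (hε : 0 < ε) {A B : Set ℝ}
    (hA : MeasurableSet A) (hB : MeasurableSet B) (hAI : A ⊆ cI) (hBI : B ⊆ cI)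
    (h : ε < |∫ p in A ×ˢ B, D p.1 p.2|) :
    ∃ σ : SignType, ∫ p in cI ×ˢ cI,
      (D p.1 p.2 - ε * ((σ : ℝ) * (A.indicator 1 p.1 * B.indicator 1 p.2)))^2 ≤
      (∫ p in cI ×ˢ cI, (D p.1 p.2)^2) - ε^2 := by
  set J := ∫ p in A ×ˢ B, D p.1 p.2 with hJ
  refine ⟨SignType.sign J, ?_⟩
  have hσ : ((SignType.sign J : SignType) : ℝ) * J = |J| := by
    rw [mul_comm]; exact self_mul_sign J
  have hσ1 : |((SignType.sign J : SignType) : ℝ)| ≤ 1 := sign_abs _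
  set σ : ℝ := ((SignType.sign J : SignType) : ℝ)
  have hDint : GKer D := gker_of_bound hD C hC
  have hsq : GKer (fun x y => (D x y)^2) := by
    refine gker_of_bound (hD.pow_const 2) (C^2) ?_
    intro x hx y hy
    rw [abs_pow]
    exact pow_le_pow_left₀ (abs_nonneg _) (hC x hx y hy) 2
  have hind : IntegrableOn ((A ×ˢ B).indicator fun p : ℝ × ℝ => D p.1 p.2) (cI ×ˢ cI) :=
    Integrable.indicator hDint (hA.prod hB)
  have hJ2 : ∫ p in cI ×ˢ cI, (A ×ˢ B).indicator (fun p : ℝ × ℝ => D p.1 p.2) p = J := by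
    rw [setIntegral_indicator (hA.prod hB), Set.inter_eq_right.2 (Set.prod_mono hAI hBI)]
  have hle : ∫ p in cI ×ˢ cI, (D p.1 p.2 - ε * (σ * (A.indicator 1 p.1 * B.indicator 1 p.2)))^2 ≤
      ∫ p in cI ×ˢ cI, (((D p.1 p.2)^2 - (2 * ε * σ) * (A ×ˢ B).indicator (fun p : ℝ × ℝ => D p.1 p.2) p)
        + ε^2) := by
    apply integral_mono_of_nonneg
    · exact Filter.Eventually.of_forall fun p => sq_nonneg _
    · exact (Integrable.sub hsq (hind.const_mul _)).add (integrable_const _)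
    · refine Filter.Eventually.of_forall fun p => ?_
      have hs2 : σ^2 ≤ 1 := by
        rw [← sq_abs]; exact pow_le_one₀ (abs_nonneg _) hσ1
      have hε2 : 0 ≤ ε^2 := sq_nonneg _
      by_cases hp : p ∈ A ×ˢ B
      · simp only [Set.indicator_of_mem hp, Set.indicator_of_mem hp.1, Set.indicator_of_mem hp.2,
          Pi.one_apply]
        nlinarith
      · have h0 : A.indicator (1 : ℝ → ℝ) p.1 * B.indicator (1 : ℝ → ℝ) p.2 = 0 := by
          by_cases h1 : p.1 ∈ A
          · have h2 : p.2 ∉ B := fun h2 => hp ⟨h1, h2⟩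
            simp [h2]
          · simp [h1]
        simp only [Set.indicator_of_notMem hp, h0]
        nlinarith
  refine hle.trans ?_
  have e1 := integral_add (μ := volume.restrict (cI ×ˢ cI)) (Integrable.sub hsq (hind.const_mul (2 * ε * σ)))
    (integrable_const (ε^2))
  have e2 := integral_sub (μ := volume.restrict (cI ×ˢ cI)) hsq (hind.const_mul (2 * ε * σ))
  simp only [Pi.sub_apply, Function.uncurry] at e1 e2
  rw [e1, e2, integral_const_mul, hJ2, integral_const]
  simp only [probReal_univ, smul_eq_mul, one_mul]
  have : 2 * ε * σ * J = 2 * ε * |J| := by rw [mul_assoc, hσ]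
  rw [this]
  nlinarith

lemma weak_regularity_aux {W : ℝ → ℝ → ℝ} (hW : IsGraphon W) {ε : ℝ} (hε : 0 < ε) (n : ℕ) :
    ∃ (s : ℕ → SignType) (S T : ℕ → Set ℝ), (∀ i, MeasurableSet (S i)) ∧ (∀ i, MeasurableSet (T i)) ∧
      (cutNorm (fun x y => W x y - stepU ε n s S T x y) ≤ ε ∨
        ∫ p in cI ×ˢ cI, (W p.1 p.2 - stepU ε n s S T p.1 p.2)^2 ≤ 1 - n * ε^2) := by
  induction n with
  | zero =>
    refine ⟨fun _ => 0, fun _ => ∅, fun _ => ∅, fun _ => MeasurableSet.empty,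
      fun _ => MeasurableSet.empty, Or.inr ?_⟩
    have : ∫ p in cI ×ˢ cI, (W p.1 p.2 - stepU ε 0 (fun _ => 0) (fun _ => ∅) (fun _ => ∅) p.1 p.2)^2
      ≤ ∫ p in cI ×ˢ cI, (1:ℝ) := by
      apply integral_mono_of_nonneg
      · exact Filter.Eventually.of_forall fun p => sq_nonneg _
      · exact integrable_const _
      · filter_upwards [ae_restrict_mem (measurableSet_Icc.prod measurableSet_Icc)] with p hp
        have := hW.2 _ hp.1 _ hp.2
        simp only [stepU, Finset.range_zero, Finset.sum_empty, mul_zero, sub_zero]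
        exact pow_le_one₀ this.1 this.2
    refine this.trans ?_
    rw [integral_const, probReal_univ]
    simp
  | succ n ih =>
    obtain ⟨s, S, T, hS, hT, h⟩ := ih
    by_cases hc : cutNorm (fun x y => W x y - stepU ε n s S T x y) ≤ ε
    · refine ⟨fun i => if i = n then 0 else s i, S, T, hS, hT, Or.inl ?_⟩
      have : stepU ε (n+1) (fun i => if i = n then 0 else s i) S T = stepU ε n s S T := by
        ext x y
        unfold stepU
        rw [Finset.sum_range_succ]
        simp only [if_true, SignType.coe_zero, zero_mul, add_zero]
        congr 1
        apply Finset.sum_congr rfl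
        intro i hi
        rw [if_neg (Finset.mem_range.1 hi).ne]
      rw [this]
      exact hc
    · have h' := h.resolve_left hc
      have : ∃ A B : Set ℝ, MeasurableSet A ∧ MeasurableSet B ∧ A ⊆ cI ∧ B ⊆ cI ∧
          ε < |∫ p in A ×ˢ B, (W p.1 p.2 - stepU ε n s S T p.1 p.2)| := by
        by_contra hcon
        push Not at hcon
        exact hc (cutNorm_le hcon)
      obtain ⟨A, B, hA, hB, hAI, hBI, hAB⟩ := this
      obtain ⟨σ, hσ⟩ := energy_step (D := fun x y => W x y - stepU ε n s S T x y)
        (hW.1.sub (stepU_meas ε n s hS hT)) (C := 1 + ε * n) (by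
          intro x hx y hy
          refine (abs_sub _ _).trans (add_le_add ?_ (stepU_abs ε hε.le n s S T x y))
          have := hW.2 x hx y hy
          rw [abs_of_nonneg this.1]; exact this.2) hε hA hB hAI hBI hAB
      refine ⟨fun i => if i = n then σ else s i, fun i => if i = n then A else S i,
        fun i => if i = n then B else T i, ?_, ?_, Or.inr ?_⟩
      · intro i
        by_cases hi : i = n <;> simp [hi, hA, hS]
      · intro i
        by_cases hi : i = n <;> simp [hi, hB, hT]
      have e : ∀ x y, W x y - stepU ε (n+1) (fun i => if i = n then σ else s i)
          (fun i => if i = n then A else S i) (fun i => if i = n then B else T i) x y =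
          W x y - stepU ε n s S T x y - ε * ((σ : ℝ) * (A.indicator 1 x * B.indicator 1 y)) := by
        intro x y
        unfold stepU
        rw [Finset.sum_range_succ]
        simp only [if_true]
        rw [mul_add, ← sub_sub]
        congr 3
        apply Finset.sum_congr rfl
        intro i hi
        simp only [if_neg (Finset.mem_range.1 hi).ne]
      simp only [e]
      refine hσ.trans ?_
      push_cast
      linarith

lemma weak_regularity {ε : ℝ} (hε : 0 < ε) : ∃ n : ℕ, ∀ W : ℝ → ℝ → ℝ, IsGraphon W →
    ∃ (s : ℕ → SignType) (S T : ℕ → Set ℝ), (∀ i, MeasurableSet (S i)) ∧ (∀ i, MeasurableSet (T i)) ∧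
      cutNorm (fun x y => W x y - stepU ε n s S T x y) ≤ ε := by
  obtain ⟨n, hn⟩ := exists_nat_gt (1 / ε^2)
  refine ⟨n, fun W hW => ?_⟩
  obtain ⟨s, S, T, hS, hT, h⟩ := weak_regularity_aux hW hε n
  refine ⟨s, S, T, hS, hT, h.resolve_right ?_⟩
  intro h2
  have h3 : 0 ≤ ∫ p in cI ×ˢ cI, (W p.1 p.2 - stepU ε n s S T p.1 p.2)^2 :=
    integral_nonneg fun p => sq_nonneg _
  rw [div_lt_iff₀ (by positivity)] at hn
  linarith

lemma grid_approx {κ : Type} [Fintype κ] [Nonempty κ] [MeasurableSpace κ] [MeasurableSingletonClass κ]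
    (c : ℝ → κ) (hc : Measurable c) {δ : ℝ} (hδ : 0 < δ) :
    ∀ᶠ N : ℕ in Filter.atTop, ∃ g : ℤ → κ, cmu.real {x | c x ≠ g ⌊(N:ℝ) * x⌋} ≤ δ := by
  classical
  set e : κ → ℝ := fun a => ((Fintype.equivFin κ a : ℕ) : ℝ) with he
  have hsep : ∀ a b : κ, |e a - e b| < 1 → a = b := by
    intro a b hab
    have h1 : |(((Fintype.equivFin κ a : ℕ) : ℤ) - ((Fintype.equivFin κ b : ℕ) : ℤ))| < 1 := by
      have : (|(((Fintype.equivFin κ a : ℕ) : ℤ) - ((Fintype.equivFin κ b : ℕ) : ℤ))| : ℝ) < 1 := by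
        simpa [he] using hab
      exact_mod_cast this
    rw [Int.abs_lt_one_iff] at h1
    apply (Fintype.equivFin κ).injective
    apply Fin.ext
    omega
  have hem : Measurable e := measurable_of_finite e
  have hint : Integrable (fun x => e (c x)) cmu := by
    refine Integrable.mono' (integrable_const (Fintype.card κ : ℝ)) (hem.comp hc).aestronglyMeasurable ?_
    refine Filter.Eventually.of_forall fun x => ?_
    rw [Real.norm_eq_abs, abs_of_nonneg (by positivity)]
    simp only [he]
    exact_mod_cast (Fintype.equivFin κ (c x)).2.le
  obtain ⟨G, hGs, hGi, hGc, hGint⟩ := hint.exists_hasCompactSupport_integral_sub_le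
    (show 0 < δ / 4 by positivity)
  have hGu := hGs.uniformContinuous_of_continuous hGc
  rw [Metric.uniformContinuous_iff] at hGu
  obtain ⟨η, hη, hG⟩ := hGu (1/4) (by norm_num)
  obtain ⟨N0, hN0⟩ := exists_nat_gt (1 / η)
  filter_upwards [Filter.eventually_ge_atTop (N0 + 1)] with N hN
  have hNpos : (0:ℝ) < N := by
    have : 0 < N := by omega
    exact_mod_cast this
  have hNη : 1 / (N:ℝ) < η := by
    rw [div_lt_iff₀ hNpos]
    rw [div_lt_iff₀ hη] at hN0
    have : (N0:ℝ) ≤ N := by exact_mod_cast (by omega : N0 ≤ N)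
    nlinarith
  refine ⟨fun j => if h : ∃ a, |e a - G (j / N)| < 1/2 then h.choose else Classical.arbitrary κ, ?_⟩
  have hsub : {x | c x ≠ (fun j : ℤ => if h : ∃ a, |e a - G (j / N)| < 1/2 then h.choose
      else Classical.arbitrary κ) ⌊(N:ℝ) * x⌋} ⊆ {x | 1/4 ≤ ‖e (c x) - G x‖} := by
    intro x hx
    by_contra hcon
    simp only [Set.mem_ofPred_eq, not_le, Real.norm_eq_abs] at hcon
    apply hx
    have h1 : dist x ((⌊(N:ℝ) * x⌋ : ℝ) / N) < η := by
      rw [Real.dist_eq]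
      have e1 : x - (⌊(N:ℝ) * x⌋ : ℝ) / N = ((N:ℝ) * x - ⌊(N:ℝ) * x⌋) / N := by
        field_simp
      rw [e1, abs_of_nonneg (div_nonneg (by linarith [Int.floor_le ((N:ℝ) * x)]) hNpos.le)]
      refine lt_of_le_of_lt ?_ hNη
      gcongr
      linarith [Int.lt_floor_add_one ((N:ℝ) * x)]
    have h2 := hG h1
    rw [Real.dist_eq] at h2
    have h3 : |e (c x) - G ((⌊(N:ℝ) * x⌋ : ℝ) / N)| < 1/2 := by
      have := abs_sub_le (e (c x)) (G x) (G ((⌊(N:ℝ) * x⌋ : ℝ) / N))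
      linarith
    have hex : ∃ a, |e a - G ((⌊(N:ℝ) * x⌋ : ℝ) / N)| < 1/2 := ⟨_, h3⟩
    simp only [dif_pos hex]
    apply hsep
    have := hex.choose_spec
    have h5 := abs_sub_le (e (c x)) (G ((⌊(N:ℝ) * x⌋ : ℝ) / N)) (e hex.choose)
    rw [abs_sub_comm (G _) (e _)] at h5
    linarith
  refine (measureReal_mono hsub).trans ?_
  have hM := mul_meas_ge_le_integral_of_nonneg (μ := cmu) (f := fun x => ‖e (c x) - G x‖)
    (Filter.Eventually.of_forall fun x => norm_nonneg _) (hint.sub hGint).norm (1/4)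
  linarith

lemma perm_lemma {α κ : Type} [Fintype α] [DecidableEq α] [Fintype κ] [DecidableEq κ] (g g' : α → κ) :
    ∃ σ : Equiv.Perm α, (Finset.univ.filter fun i => g i ≠ g' (σ i)).card ≤
      ∑ a, ((Finset.univ.filter fun i => g i = a).card - (Finset.univ.filter fun i => g' i = a).card) := by
  classical
  rcases isEmpty_or_nonempty α with h0 | h0
  · exact ⟨1, by simp⟩
  have key : ∀ a, ∃ (A : Finset α) (f : α → α), A ⊆ (Finset.univ.filter fun i => g i = a) ∧
      A.card = min (Finset.univ.filter fun i => g i = a).card (Finset.univ.filter fun i => g' i = a).card ∧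
      Set.InjOn f A ∧ ∀ i ∈ A, g' (f i) = a := by
    intro a
    obtain ⟨A, hA, hAc⟩ := Finset.exists_subset_card_eq
      (min_le_left (Finset.univ.filter fun i => g i = a).card (Finset.univ.filter fun i => g' i = a).card)
    have hle : (A : Set α).encard ≤ ((Finset.univ.filter fun i => g' i = a : Finset α) : Set α).encard := by
      rw [Set.encard_coe_eq_coe_finsetCard, Set.encard_coe_eq_coe_finsetCard, hAc]
      exact_mod_cast min_le_right _ _
    obtain ⟨f, hf1, hf2⟩ := (A.finite_toSet).exists_injOn_of_encard_le hle
    refine ⟨A, f, hA, hAc, hf2, fun i hi => ?_⟩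
    have := hf1 hi
    simpa using this
  choose A f hA hAc hinj hmap using key
  set B : Finset α := Finset.univ.filter fun i => i ∈ A (g i) with hB
  have hBinj : Set.InjOn (fun i => f (g i) i) B := by
    intro i hi j hj hij
    have hi' : i ∈ A (g i) := by simpa [hB] using hi
    have hj' : j ∈ A (g j) := by simpa [hB] using hj
    simp only at hij
    have h1 := hmap _ _ hi'
    have h2 := hmap _ _ hj'
    have hg : g i = g j := by rw [← h1, ← h2, hij]
    rw [← hg] at hij hj'
    exact hinj _ hi' hj' hij
  obtain ⟨σ0, hσ0⟩ := Finset.exists_equiv_extend_of_card_eq (α := α) (t := (Finset.univ : Finset α))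
    (by simp) (s := B) (f := fun i => f (g i) i) (Finset.subset_univ _) hBinj
  refine ⟨σ0.trans (Equiv.subtypeUnivEquiv (by simp)), ?_⟩
  have h1 : (Finset.univ.filter fun i => g i ≠ g' ((σ0.trans (Equiv.subtypeUnivEquiv (by simp))) i)) ⊆ Bᶜ := by
    intro i hi
    simp only [Finset.mem_filter, Finset.mem_univ, true_and] at hi
    rw [Finset.mem_compl]
    intro hiB
    apply hi
    have h2 := hσ0 i hiB
    have hi' : i ∈ A (g i) := by simpa [hB] using hiB
    have h3 := hmap _ _ hi'
    have h4 : (σ0.trans (Equiv.subtypeUnivEquiv (by simp))) i = ((σ0 i : _) : α) := rfl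
    rw [h4, h2, h3]
  refine (Finset.card_le_card h1).trans ?_
  rw [Finset.card_eq_sum_card_fiberwise (f := g) (t := Finset.univ) (fun _ _ => Finset.mem_coe.2 (Finset.mem_univ _))]
  apply Finset.sum_le_sum
  intro a _
  have h2 : (Bᶜ.filter fun i => g i = a) ⊆ (Finset.univ.filter fun i => g i = a) \ A a := by
    intro i hi
    simp only [hB, Finset.mem_filter, Finset.mem_compl, Finset.mem_univ, true_and, Finset.mem_sdiff] at hi ⊢
    obtain ⟨hi1, rfl⟩ := hi
    exact ⟨rfl, hi1⟩
  refine (Finset.card_le_card h2).trans ?_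
  rw [Finset.card_sdiff_of_subset (hA a), hAc a]
  omega

/-- permute the intervals of length `1/N` -/
noncomputable def permMap (N : ℕ) (σ : Equiv.Perm ℤ) (x : ℝ) : ℝ :=
  x + ((σ ⌊(N:ℝ) * x⌋ : ℝ) - (⌊(N:ℝ) * x⌋ : ℝ)) / N

lemma permMap_floor {N : ℕ} (hN : 0 < N) (σ : Equiv.Perm ℤ) (x : ℝ) :
    ⌊(N:ℝ) * permMap N σ x⌋ = σ ⌊(N:ℝ) * x⌋ := by
  have hN' : (N:ℝ) ≠ 0 := by positivity
  have : (N:ℝ) * permMap N σ x = (N:ℝ) * x + ((σ ⌊(N:ℝ) * x⌋ - ⌊(N:ℝ) * x⌋ : ℤ) : ℝ) := by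
    unfold permMap
    push_cast
    field_simp
  rw [this, Int.floor_add_intCast]
  ring

lemma permMap_inv {N : ℕ} (hN : 0 < N) (σ : Equiv.Perm ℤ) (x : ℝ) :
    permMap N σ⁻¹ (permMap N σ x) = x := by
  have h1 : permMap N σ⁻¹ (permMap N σ x) = permMap N σ x +
    ((σ⁻¹ ⌊(N:ℝ) * permMap N σ x⌋ : ℝ) - (⌊(N:ℝ) * permMap N σ x⌋ : ℝ)) / N := rfl
  have h2 : ∀ j, σ⁻¹ (σ j) = j := fun j => σ.symm_apply_apply j
  rw [h1, permMap_floor hN, h2]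
  unfold permMap
  ring

lemma permMap_inv' {N : ℕ} (hN : 0 < N) (σ : Equiv.Perm ℤ) (x : ℝ) :
    permMap N σ (permMap N σ⁻¹ x) = x := by
  have := permMap_inv hN σ⁻¹ x
  rwa [inv_inv] at this

lemma fl_meas (N : ℕ) : Measurable (fun x : ℝ => ⌊(N:ℝ) * x⌋) :=
  Int.measurable_floor.comp (measurable_const_mul _)

lemma permMap_meas (N : ℕ) (σ : Equiv.Perm ℤ) : Measurable (permMap N σ) := by
  unfold permMap
  refine measurable_id.add (Measurable.div_const (Measurable.sub ?_ ?_) _)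
  · exact (measurable_from_top (f := fun j : ℤ => ((σ j : ℤ) : ℝ))).comp (fl_meas N)
  · exact (measurable_from_top (f := fun j : ℤ => (j : ℝ))).comp (fl_meas N)

lemma vol_split (N : ℕ) {A : Set ℝ} (hA : MeasurableSet A) :
    volume A = ∑' j : ℤ, volume (A ∩ {x | ⌊(N:ℝ) * x⌋ = j}) := by
  rw [← measure_iUnion]
  · congr 1
    ext x
    simp
  · intro i j hij
    rw [Function.onFun, Set.disjoint_left]
    rintro x ⟨-, hx⟩ ⟨-, hx'⟩
    exact hij (hx.symm.trans hx')
  · intro j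
    exact hA.inter (fl_meas N (measurableSet_singleton j))

lemma permMap_mp {N : ℕ} (hN : 0 < N) (σ : Equiv.Perm ℤ) :
    MeasurePreserving (permMap N σ) volume volume := by
  refine ⟨permMap_meas N σ, ?_⟩
  ext A hA
  rw [Measure.map_apply (permMap_meas N σ) hA, vol_split N (permMap_meas N σ hA), vol_split N hA,
    ← σ.tsum_eq (fun j => volume (A ∩ {x | ⌊(N:ℝ) * x⌋ = j}))]
  congr 1
  ext j
  have hN' : (N:ℝ) ≠ 0 := by positivity
  have : permMap N σ ⁻¹' A ∩ {x | ⌊(N:ℝ) * x⌋ = j} =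
      (fun x => x + ((σ j : ℝ) - j) / N) ⁻¹' (A ∩ {x | ⌊(N:ℝ) * x⌋ = σ j}) := by
    ext x
    simp only [Set.mem_inter_iff, Set.mem_preimage, Set.mem_ofPred_eq]
    have e : (N:ℝ) * (x + ((σ j : ℝ) - j) / N) = (N:ℝ) * x + ((σ j - j : ℤ) : ℝ) := by
      push_cast
      field_simp
    rw [e, Int.floor_add_intCast]
    constructor
    · rintro ⟨h1, h2⟩
      refine ⟨?_, by omega⟩
      unfold permMap at h1
      rwa [h2] at h1
    · rintro ⟨h1, h2⟩
      have h2' : ⌊(N:ℝ) * x⌋ = j := by omega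
      refine ⟨?_, h2'⟩
      unfold permMap
      rwa [h2']
  rw [this, measure_preimage_add_right]

lemma permMap_maps {N : ℕ} (hN : 0 < N) (σ : Equiv.Perm ℤ)
    (h1 : ∀ j : ℤ, (0 ≤ j ∧ j < N) → (0 ≤ σ j ∧ σ j < N)) (h2 : σ N = N) :
    Set.MapsTo (permMap N σ) cI cI := by
  have hN' : (0:ℝ) < N := by positivity
  intro x hx
  rcases eq_or_lt_of_le hx.2 with rfl | hlt
  · have : permMap N σ 1 = 1 := by
      unfold permMap
      simp [h2]
    rw [this]
    exact hx
  · have hj0 : 0 ≤ ⌊(N:ℝ) * x⌋ := Int.floor_nonneg.2 (mul_nonneg hN'.le hx.1)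
    have hj1 : ⌊(N:ℝ) * x⌋ < N := by
      rw [Int.floor_lt]
      push_cast
      nlinarith
    obtain ⟨h3, h4⟩ := h1 _ ⟨hj0, hj1⟩
    rw [← permMap_floor hN] at h3 h4
    rw [Int.floor_nonneg] at h3
    rw [Int.floor_lt] at h4
    push_cast at h4
    constructor
    · exact nonneg_of_mul_nonneg_right h3 hN'
    · by_contra hcon
      push Not at hcon
      nlinarith

lemma permMap_isInv {N : ℕ} (hN : 0 < N) (σ : Equiv.Perm ℤ)
    (h1 : ∀ j : ℤ, (0 ≤ σ j ∧ σ j < N) ↔ (0 ≤ j ∧ j < N)) (h2 : σ N = N) :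
    IsInvMeasurePres (permMap N σ) := by
  have m1 : Set.MapsTo (permMap N σ) cI cI := permMap_maps hN σ (fun j => (h1 j).2) h2
  have m2 : Set.MapsTo (permMap N σ⁻¹) cI cI := by
    apply permMap_maps hN
    · intro j hj
      have h3 : σ (σ⁻¹ j) = j := σ.apply_symm_apply j
      rw [← h1, h3]
      exact hj
    · rw [Equiv.Perm.inv_eq_iff_eq, h2]
  refine ⟨permMap_meas N σ, m1, ?_, permMap N σ⁻¹, permMap_meas N _, m2, ?_, ?_⟩
  · have := (permMap_mp hN σ).restrict_preimage (s := cI) measurableSet_Icc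
    have e : permMap N σ ⁻¹' cI = cI := by
      apply Set.Subset.antisymm
      · intro x hx
        have := m2 hx
        rwa [permMap_inv hN] at this
      · exact m1
    rwa [e] at this
  · intro x _
    exact permMap_inv hN σ x
  · intro x _
    exact permMap_inv' hN σ x

lemma grid_measure {N : ℕ} (hN : 0 < N) (P : ℤ → Prop) [DecidablePred P] :
    cmu.real {x | P ⌊(N:ℝ) * x⌋} = (((Finset.Ico (0:ℤ) N).filter P).card : ℝ) / N := by
  have hN' : (0:ℝ) < N := by positivity
  have hm : MeasurableSet {x : ℝ | P ⌊(N:ℝ) * x⌋} := fl_meas N (MeasurableSet.of_discrete (s := {j | P j}))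
  have e0 : cmu = volume.restrict (Set.Ico (0:ℝ) 1) := by
    exact (restrict_Ico_eq_restrict_Icc).symm
  have e1 : {x : ℝ | P ⌊(N:ℝ) * x⌋} ∩ Set.Ico (0:ℝ) 1 =
      ⋃ j ∈ ((Finset.Ico (0:ℤ) N).filter P), Set.Ico ((j:ℝ)/N) (((j:ℝ)+1)/N) := by
    have hiff : ∀ (j : ℤ) (x : ℝ), x ∈ Set.Ico ((j:ℝ)/N) (((j:ℝ)+1)/N) ↔ ⌊(N:ℝ) * x⌋ = j := by
      intro j x
      rw [Int.floor_eq_iff, Set.mem_Ico, div_le_iff₀ hN', lt_div_iff₀ hN', mul_comm x]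
    ext x
    simp only [Set.mem_iUnion, hiff, Finset.mem_filter, Finset.mem_Ico, exists_prop, Set.mem_inter_iff,
      Set.mem_ofPred_eq, Set.mem_Ico, exists_eq_right']
    rw [Int.floor_nonneg, Int.floor_lt]
    push_cast
    rw [and_comm]
    refine and_congr_left fun _ => and_congr ?_ ?_
    · constructor
      · intro h; positivity
      · intro h; exact nonneg_of_mul_nonneg_right h hN'
    · constructor
      · intro h; nlinarith
      · intro h; by_contra hc; push Not at hc; nlinarith
  rw [e0, measureReal_restrict_apply hm, e1, measureReal_def, measure_biUnion_finset]
  · simp only [Real.volume_Ico]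
    have : ∀ j : ℤ, ((j:ℝ)+1)/N - (j:ℝ)/N = 1 / N := fun j => by ring
    simp only [this, Finset.sum_const, nsmul_eq_mul, ENNReal.toReal_mul, ENNReal.toReal_natCast]
    rw [ENNReal.toReal_ofReal (by positivity)]
    ring
  · intro i _ j _ hij
    rw [Function.onFun, Set.disjoint_left]
    intro x hx hx'
    apply hij
    have hiff : ∀ (j : ℤ) (x : ℝ), x ∈ Set.Ico ((j:ℝ)/N) (((j:ℝ)+1)/N) → ⌊(N:ℝ) * x⌋ = j := by
      intro j x
      rw [Int.floor_eq_iff, Set.mem_Ico, div_le_iff₀ hN', lt_div_iff₀ hN', mul_comm x]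
      exact fun h => h
    rw [← hiff i x hx, ← hiff j x hx']
  · intro j _
    exact measurableSet_Ico

lemma card_sub_filter (s : Finset ℤ) (P : ℤ → Prop) [DecidablePred P] :
    (Finset.univ.filter fun i : s => P i).card = (s.filter P).card := by
  rw [← Finset.card_map (Function.Embedding.subtype (· ∈ s))]
  congr 1
  ext x
  simp only [Finset.mem_map, Finset.mem_filter, Finset.mem_univ, true_and,
    Function.Embedding.subtype_apply]
  constructor
  · rintro ⟨a, h1, rfl⟩
    exact ⟨a.2, h1⟩
  · rintro ⟨h1, h2⟩
    exact ⟨⟨x, h1⟩, h2, rfl⟩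

lemma real_le_add {A B C : Set ℝ} (h : A ⊆ B ∪ C) : cmu.real A ≤ cmu.real B + cmu.real C :=
  (measureReal_mono h).trans (measureReal_union_le _ _)

lemma rearrange (κ : Type) [Fintype κ] [Nonempty κ] [MeasurableSpace κ]
    [MeasurableSingletonClass κ] {δ : ℝ} (hδ : 0 < δ) :
    ∃ M : ℕ, ∀ c c' : ℝ → κ, Measurable c → Measurable c' →
      (∀ a, ⌊(M:ℝ) * cmu.real {x | c x = a}⌋₊ = ⌊(M:ℝ) * cmu.real {x | c' x = a}⌋₊) →
      ∃ φ, IsInvMeasurePres φ ∧ cmu.real {x | c x ≠ c' (φ x)} ≤ δ := by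
  classical
  set K : ℝ := ((Fintype.card κ : ℕ) : ℝ) with hK
  have hKpos : 1 ≤ K := by
    have : 1 ≤ Fintype.card κ := Fintype.card_pos
    rw [hK]; exact_mod_cast this
  have hK0 : 0 < K := by linarith
  obtain ⟨M, hM⟩ := exists_nat_gt (4 * K / δ)
  have hMpos : (0:ℝ) < M := lt_trans (by positivity) hM
  have hM1 : 1 / (M:ℝ) ≤ δ / (4 * K) := by
    rw [div_lt_iff₀ hδ] at hM
    rw [div_le_div_iff₀ hMpos (by positivity)]
    linarith
  refine ⟨M, fun c c' hc hc' hcc => ?_⟩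
  set η : ℝ := δ / (8 * K) with hη
  have hηpos : 0 < η := by positivity
  obtain ⟨N, hN, ⟨g, hg⟩, ⟨g', hg'⟩⟩ := ((Filter.eventually_gt_atTop 0).and
    ((grid_approx c hc hηpos).and (grid_approx c' hc' hηpos))).exists
  have hN' : (0:ℝ) < N := by exact_mod_cast hN
  obtain ⟨σ0, hσ0⟩ := perm_lemma (fun i : Finset.Ico (0:ℤ) N => g i) (fun i => g' i)
  set σ : Equiv.Perm ℤ := Equiv.Perm.ofSubtype σ0 with hσ
  have hσmem : ∀ j : ℤ, (0 ≤ σ j ∧ σ j < N) ↔ (0 ≤ j ∧ j < N) := by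
    intro j
    have := Equiv.Perm.ofSubtype_apply_mem_iff_mem σ0 j
    simpa only [Finset.mem_Ico] using this
  have hσN : σ N = N := by
    apply Equiv.Perm.ofSubtype_apply_of_not_mem
    simp
  have hinv := permMap_isInv hN σ hσmem hσN
  refine ⟨permMap N σ, hinv, ?_⟩
  have hclose : ∀ a, cmu.real {x | c x = a} ≤ cmu.real {x | c' x = a} + 1 / M := by
    intro a
    have h1 := Nat.lt_floor_add_one ((M:ℝ) * cmu.real {x | c x = a})
    rw [hcc a] at h1
    have h2 := Nat.floor_le (show 0 ≤ (M:ℝ) * cmu.real {x | c' x = a} by positivity)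
    have h3 : (M:ℝ) * cmu.real {x | c x = a} ≤ M * (cmu.real {x | c' x = a} + 1 / M) := by
      rw [mul_add, mul_one_div_cancel hMpos.ne']
      linarith
    exact le_of_mul_le_mul_left h3 hMpos
  have hcnt : ∀ a, ((((Finset.Ico (0:ℤ) N).filter fun j => g j = a).card -
      ((Finset.Ico (0:ℤ) N).filter fun j => g' j = a).card : ℕ) : ℝ) ≤ N * (1 / M + 2 * η) := by
    intro a
    have h1 := grid_measure hN (fun j => g j = a)
    have h2 := grid_measure hN (fun j => g' j = a)
    have h3 : cmu.real {x | g ⌊(N:ℝ) * x⌋ = a} ≤ cmu.real {x | c x = a} + cmu.real {x | c x ≠ g ⌊(N:ℝ) * x⌋} := by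
      apply real_le_add
      intro x hx
      by_cases hcx : c x = g ⌊(N:ℝ) * x⌋
      · left; exact hcx.trans hx
      · right; exact hcx
    have h4 : cmu.real {x | c' x = a} ≤ cmu.real {x | g' ⌊(N:ℝ) * x⌋ = a} + cmu.real {x | c' x ≠ g' ⌊(N:ℝ) * x⌋} := by
      apply real_le_add
      intro x hx
      by_cases hcx : c' x = g' ⌊(N:ℝ) * x⌋
      · left; exact hcx.symm.trans hx
      · right; exact hcx
    have h5 := hclose a
    rcases le_total (((Finset.Ico (0:ℤ) N).filter fun j => g j = a).card)
      (((Finset.Ico (0:ℤ) N).filter fun j => g' j = a).card) with h | h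
    · rw [Nat.sub_eq_zero_of_le h]
      push_cast
      positivity
    · rw [Nat.cast_sub h, mul_comm, ← div_le_iff₀ hN', sub_div, ← h1, ← h2]
      linarith
  have hdis : cmu.real {x | g ⌊(N:ℝ) * x⌋ ≠ g' (σ ⌊(N:ℝ) * x⌋)} ≤ K * (1 / M + 2 * η) := by
    rw [grid_measure hN (fun j => g j ≠ g' (σ j)), div_le_iff₀ hN']
    have e1 : (((Finset.Ico (0:ℤ) N).filter fun j => g j ≠ g' (σ j)).card) ≤
        ∑ a, ((((Finset.Ico (0:ℤ) N).filter fun j => g j = a).card -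
      ((Finset.Ico (0:ℤ) N).filter fun j => g' j = a).card : ℕ)) := by
      simp only [← card_sub_filter]
      refine le_trans (le_of_eq ?_) hσ0
      congr 1
      apply Finset.filter_congr
      intro i _
      rw [hσ, Equiv.Perm.ofSubtype_apply_coe]
    have e2 : ((((Finset.Ico (0:ℤ) N).filter fun j => g j ≠ g' (σ j)).card : ℕ) : ℝ) ≤
        ∑ a : κ, (N * (1 / M + 2 * η) : ℝ) := by
      refine le_trans (Nat.cast_le.2 e1) ?_
      rw [Nat.cast_sum]
      exact Finset.sum_le_sum fun a _ => hcnt a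
    rw [Finset.sum_const, Finset.card_univ, nsmul_eq_mul, ← hK] at e2
    linarith
  have hpre : cmu.real {x | c' (permMap N σ x) ≠ g' ⌊(N:ℝ) * permMap N σ x⌋} =
      cmu.real {x | c' x ≠ g' ⌊(N:ℝ) * x⌋} := by
    have hm : MeasurableSet {x | c' x ≠ g' ⌊(N:ℝ) * x⌋} := by
      have : Measurable fun x => g' ⌊(N:ℝ) * x⌋ := (measurable_from_top (f := g')).comp (fl_meas N)
      exact (measurableSet_eq_fun hc' this).compl
    have := hinv.2.2.1.measure_preimage hm.nullMeasurableSet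
    unfold Measure.real
    rw [← this]
    rfl
  have hfin : cmu.real {x | c x ≠ c' (permMap N σ x)} ≤ cmu.real {x | c x ≠ g ⌊(N:ℝ) * x⌋} +
      (cmu.real {x | g ⌊(N:ℝ) * x⌋ ≠ g' (σ ⌊(N:ℝ) * x⌋)} +
        cmu.real {x | c' (permMap N σ x) ≠ g' ⌊(N:ℝ) * permMap N σ x⌋}) := by
    refine le_trans ?_ (add_le_add le_rfl (measureReal_union_le _ _))
    apply real_le_add
    intro x hx
    by_cases h1 : c x = g ⌊(N:ℝ) * x⌋
    · right
      by_cases h2 : g ⌊(N:ℝ) * x⌋ = g' (σ ⌊(N:ℝ) * x⌋)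
      · right
        intro h3
        rw [permMap_floor hN] at h3
        exact hx (by rw [h1, h2, h3])
      · left; exact h2
    · left; exact h1
  rw [hpre] at hfin
  have h6 : K * (1 / M + 2 * η) ≤ δ / 2 := by
    have : K * (1 / M + 2 * η) ≤ K * (δ / (4 * K) + 2 * η) := by gcongr
    refine this.trans (le_of_eq ?_)
    rw [hη]
    field_simp
    ring
  have h7 : η ≤ δ / 8 := by
    rw [hη]
    gcongr
    linarith
  linarith

/-- the membership pattern of a point -/
noncomputable def pattern (n : ℕ) (S : ℕ → Set ℝ) (x : ℝ) : Fin n → Bool :=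
  open Classical in fun i => decide (x ∈ S i)

lemma pattern_meas (n : ℕ) {S : ℕ → Set ℝ} (hS : ∀ i, MeasurableSet (S i)) :
    Measurable (pattern n S) := by
  apply measurable_pi_lambda
  intro i
  apply measurable_to_bool
  have : (fun x => pattern n S x i) ⁻¹' {true} = S i := by
    ext x
    simp [pattern]
  rw [this]
  exact hS i

lemma stepU_congr (ε : ℝ) (n : ℕ) {s s' : ℕ → SignType} {S S' T T' : ℕ → Set ℝ} {x x' y y' : ℝ}
    (hs : ∀ i < n, s i = s' i) (hx : pattern n S x = pattern n S' x')
    (hy : pattern n T y = pattern n T' y') :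
    stepU ε n s S T x y = stepU ε n s' S' T' x' y' := by
  classical
  unfold stepU
  congr 1
  apply Finset.sum_congr rfl
  intro i hi
  have hin := Finset.mem_range.1 hi
  have h1 : x ∈ S i ↔ x' ∈ S' i := by
    have := congrFun hx ⟨i, hin⟩
    simpa [pattern] using this
  have h2 : y ∈ T i ↔ y' ∈ T' i := by
    have := congrFun hy ⟨i, hin⟩
    simpa [pattern] using this
  simp only [hs i hin, Set.indicator_apply, h1, h2]
  rfl

lemma stepU_diff {ε : ℝ} (hε : 0 ≤ ε) (n : ℕ) {s s' : ℕ → SignType} {S S' T T' : ℕ → Set ℝ}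
    (hS : ∀ i, MeasurableSet (S i)) (hT : ∀ i, MeasurableSet (T i))
    (hS' : ∀ i, MeasurableSet (S' i)) (hT' : ∀ i, MeasurableSet (T' i))
    (hs : ∀ i < n, s i = s' i) {φ ψ : ℝ → ℝ} (hφ : IsInvMeasurePres φ) (hψ : IsInvMeasurePres ψ)
    {δ : ℝ} (h1 : cmu.real {x | pattern n S x ≠ pattern n S' (φ x)} ≤ δ)
    (h2 : cmu.real {x | pattern n T x ≠ pattern n T' (ψ x)} ≤ δ) :
    cutNorm (fun x y => stepU ε n s S T x y - stepU ε n s' S' T' (φ x) (ψ y)) ≤ 4 * ε * n * δ := by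
  have hg := (stepU_gker ε hε n s hS hT).sub ((stepU_gker ε hε n s' hS' hT').comp hφ hψ)
  refine (cutNorm_le_integral hg).trans ?_
  set E := {x | pattern n S x ≠ pattern n S' (φ x)} with hE
  set F := {x | pattern n T x ≠ pattern n T' (ψ x)} with hF
  have hEm : MeasurableSet E :=
    (measurableSet_eq_fun (pattern_meas n hS) ((pattern_meas n hS').comp hφ.1)).compl
  have hFm : MeasurableSet F :=
    (measurableSet_eq_fun (pattern_meas n hT) ((pattern_meas n hT').comp hψ.1)).compl
  rw [← cmu_prod]
  have iE : Integrable (E.indicator (1 : ℝ → ℝ)) cmu := (integrable_const (1:ℝ)).indicator hEm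
  have iF : Integrable (F.indicator (1 : ℝ → ℝ)) cmu := (integrable_const (1:ℝ)).indicator hFm
  have iE2 : Integrable (fun p : ℝ × ℝ => E.indicator (1 : ℝ → ℝ) p.1) (cmu.prod cmu) := iE.comp_fst cmu
  have iF2 : Integrable (fun p : ℝ × ℝ => F.indicator (1 : ℝ → ℝ) p.2) (cmu.prod cmu) := iF.comp_snd cmu
  have hle : ∫ p, |stepU ε n s S T p.1 p.2 - stepU ε n s' S' T' (φ p.1) (ψ p.2)| ∂(cmu.prod cmu) ≤
      ∫ p, (2 * ε * n) * (E.indicator (1 : ℝ → ℝ) p.1 + F.indicator (1 : ℝ → ℝ) p.2) ∂(cmu.prod cmu) := by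
    apply integral_mono_of_nonneg
    · exact Filter.Eventually.of_forall fun p => abs_nonneg _
    · exact (iE2.add iF2).const_mul _
    · refine Filter.Eventually.of_forall fun p => ?_
      simp only
      have hEnn : 0 ≤ E.indicator (1 : ℝ → ℝ) p.1 := Set.indicator_nonneg (fun _ _ => zero_le_one) _
      have hFnn : 0 ≤ F.indicator (1 : ℝ → ℝ) p.2 := Set.indicator_nonneg (fun _ _ => zero_le_one) _
      have hC : 0 ≤ 2 * ε * n := by positivity
      have hb : |stepU ε n s S T p.1 p.2 - stepU ε n s' S' T' (φ p.1) (ψ p.2)| ≤ 2 * ε * n := by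
        refine (abs_sub _ _).trans ?_
        have := stepU_abs ε hε n s S T p.1 p.2
        have := stepU_abs ε hε n s' S' T' (φ p.1) (ψ p.2)
        linarith
      by_cases hp : p.1 ∈ E
      · rw [Set.indicator_of_mem hp, Pi.one_apply]
        nlinarith
      · by_cases hq : p.2 ∈ F
        · rw [Set.indicator_of_mem hq, Pi.one_apply]
          nlinarith
        · have e := stepU_congr ε n hs (not_not.1 hp) (not_not.1 hq)
          rw [e, sub_self, abs_zero]
          positivity
  refine hle.trans ?_
  rw [integral_const_mul, integral_add iE2 iF2, integral_fun_fst, integral_fun_snd,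
    integral_indicator_one hEm, integral_indicator_one hFm]
  simp only [probReal_univ, one_smul]
  have hC : 0 ≤ 2 * ε * n := by positivity
  nlinarith

lemma graphon_tb : TotallyBounded (Set.univ : Set Graphon) := by
  apply Metric.totallyBounded_of_finite_discretization
  intro ε0 hε0
  have hε : 0 < ε0 / 4 := by positivity
  set ε := ε0 / 4 with hεdef
  obtain ⟨n, hn⟩ := weak_regularity hε
  have hδ : (0:ℝ) < 1 / (4 * n + 4) := by positivity
  set δ : ℝ := 1 / (4 * n + 4) with hδdef
  obtain ⟨M, hM⟩ := rearrange (Fin n → Bool) hδ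
  choose s S T hS hT hcut using hn
  let fl : (ℝ → (Fin n → Bool)) → (Fin n → Bool) → Fin (M + 1) := fun c a =>
    ⟨⌊(M:ℝ) * cmu.real {x | c x = a}⌋₊, by
      rw [Nat.lt_succ_iff]
      apply Nat.floor_le_of_le
      have : cmu.real {x | c x = a} ≤ 1 := measureReal_le_one
      nlinarith [Nat.cast_nonneg (α := ℝ) M]⟩
  refine ⟨(Fin n → SignType) × ((Fin n → Bool) → Fin (M + 1)) × ((Fin n → Bool) → Fin (M + 1)),
    inferInstance, fun W => (fun i => s W.1.1 W.1.2 i, fl (pattern n (S W.1.1 W.1.2)),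
      fl (pattern n (T W.1.1 W.1.2))), ?_⟩
  rintro ⟨U, hU⟩ ⟨V, hV⟩ h
  rw [Prod.mk.injEq, Prod.mk.injEq] at h
  obtain ⟨e1, e2, e3⟩ := h
  simp only at e1 e2 e3
  obtain ⟨φ, hφ, hφ2⟩ := hM _ _ (pattern_meas n (hS U.1 U.2)) (pattern_meas n (hS V.1 V.2))
    (fun a => Fin.mk.inj (congrFun e2 a))
  obtain ⟨ψ, hψ, hψ2⟩ := hM _ _ (pattern_meas n (hT U.1 U.2)) (pattern_meas n (hT V.1 V.2))
    (fun a => Fin.mk.inj (congrFun e3 a))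
  have hd := stepU_diff hε.le n (hS U.1 U.2) (hT U.1 U.2) (hS V.1 V.2) (hT V.1 V.2)
    (fun i hi => congrFun e1 ⟨i, hi⟩) hφ hψ hφ2 hψ2
  have gU := stepU_gker ε hε.le n (s U.1 U.2) (hS U.1 U.2) (hT U.1 U.2)
  have gV := stepU_gker ε hε.le n (s V.1 V.2) (hS V.1 V.2) (hT V.1 V.2)
  have a1 := hcut U.1 U.2
  have a2 := (cutNorm_comp_le (V.2.gker.sub gV) hφ hψ).trans (hcut V.1 V.2)
  rw [← cutNorm_neg] at a2
  have hA := U.2.gker.sub gU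
  have hB := gU.sub (gV.comp hφ hψ)
  have hC : GKer (fun x y => -(V.1 (φ x) (ψ y) - stepU ε n (s V.1 V.2) (S V.1 V.2) (T V.1 V.2) (φ x) (ψ y))) :=
    Integrable.neg ((V.2.gker.sub gV).comp hφ hψ)
  have t1 := cutNorm_add_le hA (hB.add hC)
  have t2 := cutNorm_add_le hB hC
  have t3 : cutDist U.1 V.1 ≤ _ := cutDist_le U.1 V.1 hφ hψ
  have e4 : (fun x y => U.1 x y - V.1 (φ x) (ψ y)) = fun x y =>
      (U.1 x y - stepU ε n (s U.1 U.2) (S U.1 U.2) (T U.1 U.2) x y) +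
      ((stepU ε n (s U.1 U.2) (S U.1 U.2) (T U.1 U.2) x y -
        stepU ε n (s V.1 V.2) (S V.1 V.2) (T V.1 V.2) (φ x) (ψ y)) +
        -(V.1 (φ x) (ψ y) - stepU ε n (s V.1 V.2) (S V.1 V.2) (T V.1 V.2) (φ x) (ψ y))) := by
    ext x y
    ring
  rw [e4] at t3
  have h5 : 4 * ε * n * δ ≤ ε := by
    rw [hδdef, mul_one_div, div_le_iff₀ (by positivity)]
    nlinarith
  change cutDist U.1 V.1 < ε0
  have : ε0 = 4 * ε := by rw [hεdef]; ring
  linarith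

/-- Sequential compactness of the space of graphons for the cut distance. -/
theorem stmt_5 (W : ℕ → ℝ → ℝ → ℝ)
    (hmeas : ∀ n, Measurable (Function.uncurry (W n)))
    (hrange : ∀ n, ∀ x ∈ Set.Icc (0:ℝ) 1, ∀ y ∈ Set.Icc (0:ℝ) 1,
      W n x y ∈ Set.Icc (0:ℝ) 1) :
    ∃ φ : ℕ → ℕ, StrictMono φ ∧ ∃ L : ℝ → ℝ → ℝ,
      Measurable (Function.uncurry L) ∧
      (∀ x ∈ Set.Icc (0:ℝ) 1, ∀ y ∈ Set.Icc (0:ℝ) 1, L x y ∈ Set.Icc (0:ℝ) 1) ∧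
      Filter.Tendsto (fun k => cutDist (W (φ k)) L) Filter.atTop (nhds 0) := by
  have := graphon_complete
  have hcomp : IsCompact (Set.univ : Set Graphon) :=
    isCompact_iff_totallyBounded_isComplete.mpr ⟨graphon_tb, isComplete_univ⟩
  let u : ℕ → Graphon := fun n => ⟨W n, hmeas n, hrange n⟩
  obtain ⟨L, -, φ, hφ, hlim⟩ := hcomp.isSeqCompact (x := u) (fun n => Set.mem_univ _)
  refine ⟨φ, hφ, L.1, L.2.1, L.2.2, ?_⟩
  exact tendsto_iff_dist_tendsto_zero.1 hlim
end
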